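/- There exists a positive measure R*_s on 𝒵 whose Laplace transform satisfies L_{R*_s}(θ) = Δ_{−s}(θ) for all θ ∈ 𝒫 if and only if s ∈ 𝔛 := ⋃_{ε ∈ {0,1}^r} 𝔛(ε) (a disjoint union), where 𝔛(ε) := {s ∈ ℝ^r : s_k > ½ Σ_{l>k} ε_l dim 𝒱_{lk} if ε_k = 1, and s_k = ½ Σ_{l>k} ε_l dim 𝒱_{lk} if ε_k = 0}. Moreover the support of R*_s is contained in the closure of 𝒬. -/

import Mathlib

open Matrix MeasureTheory Finset
open scoped ENNReal

namespace Wishart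

instance {m n α : Type*} [MeasurableSpace α] : MeasurableSpace (Matrix m n α) :=
  inferInstanceAs (MeasurableSpace (m → n → α))

/-- Index set of an `N × N` matrix partitioned into `r + 1` blocks of sizes `n 0, …, n r`. -/
abbrev Idx (r : ℕ) (n : Fin (r + 1) → ℕ+) := Σ k : Fin (r + 1), Fin (n k)

/-- Real matrices over the partitioned index set. -/
abbrev Mat (r : ℕ) (n : Fin (r + 1) → ℕ+) := Matrix (Idx r n) (Idx r n) ℝ

variable {r : ℕ} {n : Fin (r + 1) → ℕ+}

/-- The `(l,k)` block of a partitioned matrix. -/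
def blk (x : Mat r n) (l k : Fin (r + 1)) : Matrix (Fin (n l)) (Fin (n k)) ℝ :=
  Matrix.of fun a b => x ⟨l, a⟩ ⟨k, b⟩

variable (V : ∀ l k : Fin (r + 1), Submodule ℝ (Matrix (Fin (n l)) (Fin (n k)) ℝ))

/-- Condition (V1): `A ∈ 𝒱_{lk}`, `B ∈ 𝒱_{ki}` implies `A B ∈ 𝒱_{li}` for `i < k < l`. -/
def CondV1 : Prop := ∀ i k l : Fin (r + 1), i < k → k < l →
  ∀ A ∈ V l k, ∀ B ∈ V k i, A * B ∈ V l i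

/-- Condition (V2): `A ∈ 𝒱_{li}`, `B ∈ 𝒱_{ki}` implies `A Bᵀ ∈ 𝒱_{lk}` for `i < k < l`. -/
def CondV2 : Prop := ∀ i k l : Fin (r + 1), i < k → k < l →
  ∀ A ∈ V l i, ∀ B ∈ V k i, A * Bᵀ ∈ V l k

/-- Condition (V3): `A ∈ 𝒱_{lk}` implies `A Aᵀ ∈ ℝ I`. -/
def CondV3 : Prop := ∀ k l : Fin (r + 1), k < l →
  ∀ A ∈ V l k, ∃ c : ℝ, A * Aᵀ = c • (1 : Matrix (Fin (n l)) (Fin (n l)) ℝ)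

/-- The space `𝒵` of symmetric matrices with lower blocks in `𝒱_{lk}` and scalar diagonal
blocks. -/
def Zspace : Set (Mat r n) :=
  {x | x.IsSymm ∧ (∀ k l : Fin (r + 1), k < l → blk x l k ∈ V l k) ∧
    ∀ k : Fin (r + 1), ∃ c : ℝ, ∀ a b : Fin (n k),
      x ⟨k, a⟩ ⟨k, b⟩ = if a = b then c else 0}

/-- The trace inner product `⟨x, y⟩ = tr (x y)`. -/
def tip (x y : Mat r n) : ℝ := (x * y).trace

/-- The homogeneous cone `𝒫 = 𝒵 ∩ Sym₊(N, ℝ)`. -/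
def Pcone : Set (Mat r n) := {x | x ∈ Zspace V ∧ x.PosDef}

/-- The dual cone `𝒬 = {ξ ∈ 𝒵 : ⟨ξ, x⟩ > 0 for all nonzero x in the closure of 𝒫}`. -/
def Qcone : Set (Mat r n) :=
  {ξ | ξ ∈ Zspace V ∧ ∀ x ∈ closure (Pcone V), x ≠ 0 → 0 < tip ξ x}

/-- The group `H` of block lower triangular matrices with strictly lower blocks in `𝒱_{lk}`
and positive scalar diagonal blocks. -/
def Hgrp : Set (Mat r n) :=
  {T | (∀ k l : Fin (r + 1), l < k → blk T l k = 0) ∧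
    (∀ k l : Fin (r + 1), k < l → blk T l k ∈ V l k) ∧
    ∀ k : Fin (r + 1), ∃ t : ℝ, 0 < t ∧ ∀ a b : Fin (n k),
      T ⟨k, a⟩ ⟨k, b⟩ = if a = b then t else 0}

/-- `ρ(T) x = T x Tᵀ`. -/
def rhoM (T x : Mat r n) : Mat r n := T * x * Tᵀ

/-- The diagonal scalar `t_{kk}` of a matrix with scalar diagonal blocks. -/
def tdiag (T : Mat r n) (k : Fin (r + 1)) : ℝ :=
  T ⟨k, ⟨0, (n k).2⟩⟩ ⟨k, ⟨0, (n k).2⟩⟩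

/-- The one-dimensional representation `χ_s(T) = ∏_k t_{kk}^{2 s_k}`. -/
noncomputable def chi (s : Fin (r + 1) → ℝ) (T : Mat r n) : ℝ :=
  ∏ k : Fin (r + 1), tdiag T k ^ (2 * s k)

/-- `½ Σ_{i<k} ε_i dim 𝒱_{ki}`. -/
noncomputable def xiBound (ε : Fin (r + 1) → Bool) (k : Fin (r + 1)) : ℝ :=
  (1 / 2) * ∑ i ∈ Finset.univ.filter (fun i => i < k),
    (if ε i then (Module.finrank ℝ (V k i) : ℝ) else 0)

/-- The Gindikin set `Ξ`. -/
def XiSet : Set (Fin (r + 1) → ℝ) :=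
  ⋃ ε : Fin (r + 1) → Bool,
    {s | ∀ k, (ε k = true → xiBound V ε k < s k) ∧ (ε k = false → s k = xiBound V ε k)}

/-- `½ Σ_{l>k} ε_l dim 𝒱_{lk}`. -/
noncomputable def frakBound (ε : Fin (r + 1) → Bool) (k : Fin (r + 1)) : ℝ :=
  (1 / 2) * ∑ l ∈ Finset.univ.filter (fun l => k < l),
    (if ε l then (Module.finrank ℝ (V l k) : ℝ) else 0)

/-- The Gindikin set `𝔛`. -/
def frakX : Set (Fin (r + 1) → ℝ) :=
  ⋃ ε : Fin (r + 1) → Bool,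
    {s | ∀ k, (ε k = true → frakBound V ε k < s k) ∧ (ε k = false → s k = frakBound V ε k)}

/-- Laplace transform `L_μ(θ) = ∫ e^{-⟨θ,x⟩} dμ(x)` (with values in `[0,∞]`). -/
noncomputable def laplace (μ : Measure (Mat r n)) (θ : Mat r n) : ℝ≥0∞ :=
  ∫⁻ x, ENNReal.ofReal (Real.exp (-(tip θ x))) ∂μ

/-- Real-valued Laplace transform. -/
noncomputable def laplaceR (μ : Measure (Mat r n)) (θ : Mat r n) : ℝ :=
  ∫ x, Real.exp (-(tip θ x)) ∂μ

/-- Mean of the natural-exponential-family member `P(θ,μ)`, computed entrywise: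
`m_μ(θ) = L_μ(θ)⁻¹ ∫ x e^{-⟨θ,x⟩} dμ(x)`. -/
noncomputable def meanMap (μ : Measure (Mat r n)) (θ : Mat r n) : Mat r n :=
  Matrix.of fun p q => (laplaceR μ θ)⁻¹ * ∫ x, Real.exp (-(tip θ x)) * x p q ∂μ

/-- Covariance operator of `P(θ,μ)` with mean `m`, applied to `ξ ∈ 𝒵` (entrywise):
`V ξ = ∫ ⟨ξ, x - m⟩ (x - m) dP(θ,μ)(x)`. -/
noncomputable def varOp (μ : Measure (Mat r n)) (θ m ξ : Mat r n) : Mat r n :=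
  Matrix.of fun p q =>
    (laplaceR μ θ)⁻¹ * ∫ x, Real.exp (-(tip θ x)) * tip ξ (x - m) * ((x - m) p q) ∂μ

/-- Leading principal submatrix `y_{{1:k}}` consisting of the blocks with indices `≤ k`. -/
def lead (k : Fin (r + 1)) (y : Mat r n) :
    Matrix {p : Idx r n // p.1 ≤ k} {p : Idx r n // p.1 ≤ k} ℝ :=
  Matrix.of fun p q => y p.1 q.1

/-- Zero-padding `z₀` of a matrix `z` defined on the blocks with indices `≤ k`. -/
def pad (k : Fin (r + 1)) (z : Matrix {p : Idx r n // p.1 ≤ k} {p : Idx r n // p.1 ≤ k} ℝ) :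
    Mat r n :=
  Matrix.of fun p q => if h : p.1 ≤ k ∧ q.1 ≤ k then z ⟨p, h.1⟩ ⟨q, h.2⟩ else 0

/-- `J_k = (I_{N_k})₀`. -/
def Jmat (k : Fin (r + 1)) : Mat r n := pad k 1

/-- Parameters of elements of `W_i`: the scalar `x_{ii}` and the blocks `X_{li}`. -/
abbrev Wparam (r : ℕ) (n : Fin (r + 1) → ℕ+) (i : Fin (r + 1)) :=
  ℝ × ∀ l : Fin (r + 1), Matrix (Fin (n l)) (Fin (n i)) ℝ

/-- The `N × n_i` matrix in `W_i` with `i`-th block row `x_{ii} I` and `l`-th block row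
`X_{li}` for `l > i`. -/
def toW (i : Fin (r + 1)) (p : Wparam r n i) : Matrix (Idx r n) (Fin (n i)) ℝ :=
  Matrix.of fun q b =>
    if q.1 = i then (if (q.2 : ℕ) = (b : ℕ) then p.1 else 0)
    else if i < q.1 then p.2 q.1 q.2 b else 0

/-- A parameter tuple gives an honest element of `W_i`: blocks lie in `𝒱_{li}` and vanish
for `l ≤ i`. -/
def WGood (i : Fin (r + 1)) (p : Wparam r n i) : Prop :=
  (∀ l : Fin (r + 1), i < l → p.2 l ∈ V l i) ∧ (∀ l : Fin (r + 1), ¬ i < l → p.2 l = 0)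

/-- The inner product `(A|B)` on `𝒱_{lk}`, characterized by `(ABᵀ + BAᵀ)/2 = (A|B) I`. -/
noncomputable def bip (l : Fin (r + 1)) {k : Fin (r + 1)}
    (A B : Matrix (Fin (n l)) (Fin (n k)) ℝ) : ℝ :=
  (A * Bᵀ).trace / (n l : ℝ)

open scoped Classical in
/-- The generalized power function `Δ_s` on `𝒫`, defined by `Δ_s(ρ(T) I) = χ_s(T)`. -/
noncomputable def DeltaDef (s : Fin (r + 1) → ℝ) (x : Mat r n) : ℝ :=
  if h : ∃ T, T ∈ Hgrp V ∧ x = rhoM T 1 then chi s h.choose else 0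

/-- Index set for the block diagonal matrix `Φ(ξ) = diag(φ_0(ξ), …, φ_r(ξ))`,
where `φ_i(ξ)` is of size `m_i = mdc i + 1`. -/
abbrev DIdx (r : ℕ) (mdc : Fin (r + 1) → ℕ) := Σ i : Fin (r + 1), Fin (mdc i + 1)

/-- The block diagonal matrix `Φ(ξ) = diag(φ_0(ξ), …, φ_r(ξ))`. -/
def PhiMat {mdc : Fin (r + 1) → ℕ}
    (φ : ∀ i : Fin (r + 1), Mat r n → Matrix (Fin (mdc i + 1)) (Fin (mdc i + 1)) ℝ)
    (ξ : Mat r n) : Matrix (DIdx r mdc) (DIdx r mdc) ℝ :=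
  Matrix.of fun p q =>
    if h : p.1 = q.1 then φ p.1 ξ p.2 (Fin.cast (by rw [h]) q.2) else 0

/-- `Φ(I_N)^{-1/2}`: the inverse square root of the (diagonal, positive) matrix `Φ(I_N)`. -/
noncomputable def PhiISqrtInv {mdc : Fin (r + 1) → ℕ}
    (φ : ∀ i : Fin (r + 1), Mat r n → Matrix (Fin (mdc i + 1)) (Fin (mdc i + 1)) ℝ) :
    Matrix (DIdx r mdc) (DIdx r mdc) ℝ :=
  Matrix.diagonal fun p => (PhiMat φ (1 : Mat r n) p p) ^ (-(1 / 2) : ℝ)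

section Riesz

variable {V}

@[simp] theorem blk_apply (x : Mat r n) (l k : Fin (r + 1)) (a : Fin (n l)) (b : Fin (n k)) :
    blk x l k a b = x ⟨l, a⟩ ⟨k, b⟩ := rfl

theorem blk_mul (x y : Mat r n) (l k : Fin (r + 1)) :
    blk (x * y) l k = ∑ j, blk x l j * blk y j k := by
  ext a b
  simp [Matrix.mul_apply, Matrix.sum_apply, Fintype.sum_sigma]

theorem blk_add (x y : Mat r n) (l k : Fin (r + 1)) :
    blk (x + y) l k = blk x l k + blk y l k := rfl

theorem blk_smul (c : ℝ) (x : Mat r n) (l k : Fin (r + 1)) :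
    blk (c • x) l k = c • blk x l k := rfl

theorem blk_transpose (x : Mat r n) (l k : Fin (r + 1)) : blk xᵀ l k = (blk x k l)ᵀ := rfl

theorem blk_zero (l k : Fin (r + 1)) : blk (0 : Mat r n) l k = 0 := rfl

theorem blk_one_self (k : Fin (r + 1)) : blk (1 : Mat r n) k k = 1 := by
  ext a b
  simp [Matrix.one_apply]

theorem blk_one_ne {l k : Fin (r + 1)} (h : l ≠ k) : blk (1 : Mat r n) l k = 0 := by
  ext a b
  simp [h]

theorem blk_diag_iff {x : Mat r n} {k : Fin (r + 1)} {c : ℝ} :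
    (∀ a b : Fin (n k), x ⟨k, a⟩ ⟨k, b⟩ = if a = b then c else 0) ↔ blk x k k = c • 1 := by
  simp only [← Matrix.ext_iff, blk_apply, Matrix.smul_apply, Matrix.one_apply, smul_eq_mul,
    mul_ite, mul_one, mul_zero]

theorem tdiag_eq {x : Mat r n} {k : Fin (r + 1)} {c : ℝ} (h : blk x k k = c • 1) :
    tdiag x k = c := by
  have := blk_diag_iff.2 h ⟨0, (n k).2⟩ ⟨0, (n k).2⟩
  simpa [tdiag] using this

variable (V) in
/-- Block lower triangular matrices with blocks in `V` and scalar diagonal blocks. -/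
def lowT : Submodule ℝ (Mat r n) where
  carrier := {T | (∀ k l : Fin (r + 1), l < k → blk T l k = 0) ∧
    (∀ k l : Fin (r + 1), k < l → blk T l k ∈ V l k) ∧
    ∀ k : Fin (r + 1), ∃ t : ℝ, blk T k k = t • 1}
  add_mem' := by
    rintro x y ⟨h1, h2, h3⟩ ⟨g1, g2, g3⟩
    refine ⟨fun k l h => by rw [blk_add, h1 k l h, g1 k l h, add_zero],
      fun k l h => add_mem (h2 k l h) (g2 k l h), fun k => ?_⟩
    obtain ⟨a, ha⟩ := h3 k
    obtain ⟨b, hb⟩ := g3 k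
    exact ⟨a + b, by rw [blk_add, ha, hb, add_smul]⟩
  zero_mem' := ⟨fun _ _ _ => rfl, fun k l _ => (V l k).zero_mem, fun k => ⟨0, by simp [blk_zero]⟩⟩
  smul_mem' := by
    rintro c x ⟨h1, h2, h3⟩
    refine ⟨fun k l h => by rw [blk_smul, h1 k l h, smul_zero],
      fun k l h => (V l k).smul_mem c (h2 k l h), fun k => ?_⟩
    obtain ⟨a, ha⟩ := h3 k
    exact ⟨c * a, by rw [blk_smul, ha, mul_smul]⟩

theorem lowT_diag {T : Mat r n} (hT : T ∈ lowT V) (k : Fin (r + 1)) :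
    blk T k k = tdiag T k • 1 := by
  obtain ⟨t, ht⟩ := hT.2.2 k
  rw [tdiag_eq ht, ht]

theorem mem_Hgrp_iff {T : Mat r n} : T ∈ Hgrp V ↔ T ∈ lowT V ∧ ∀ k, 0 < tdiag T k := by
  constructor
  · rintro ⟨h1, h2, h3⟩
    refine ⟨⟨h1, h2, fun k => ?_⟩, fun k => ?_⟩ <;> obtain ⟨t, h0, ht⟩ := h3 k
    · exact ⟨t, blk_diag_iff.1 ht⟩
    · rwa [tdiag_eq (blk_diag_iff.1 ht)]
  · rintro ⟨h, hpos⟩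
    exact ⟨h.1, h.2.1, fun k => ⟨tdiag T k, hpos k, blk_diag_iff.2 (lowT_diag h k)⟩⟩

variable (V) in
/-- `𝒵` as a submodule. -/
def Zsub : Submodule ℝ (Mat r n) where
  carrier := Zspace V
  add_mem' := by
    rintro x y ⟨h1, h2, h3⟩ ⟨g1, g2, g3⟩
    refine ⟨h1.add g1, fun k l h => add_mem (h2 k l h) (g2 k l h), fun k => ?_⟩
    obtain ⟨a, ha⟩ := h3 k
    obtain ⟨b, hb⟩ := g3 k
    refine ⟨a + b, blk_diag_iff.2 ?_⟩
    rw [blk_add, blk_diag_iff.1 ha, blk_diag_iff.1 hb, add_smul]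
  zero_mem' := ⟨Matrix.isSymm_zero, fun k l _ => (V l k).zero_mem, fun k => ⟨0, by simp⟩⟩
  smul_mem' := by
    rintro c x ⟨h1, h2, h3⟩
    refine ⟨h1.smul c, fun k l h => (V l k).smul_mem c (h2 k l h), fun k => ?_⟩
    obtain ⟨a, ha⟩ := h3 k
    refine ⟨c * a, blk_diag_iff.2 ?_⟩
    rw [blk_smul, blk_diag_iff.1 ha, mul_smul]

theorem mem_Zsub {x : Mat r n} : x ∈ Zsub V ↔ x ∈ Zspace V := Iff.rfl

theorem mem_Zspace_iff {x : Mat r n} : x ∈ Zspace V ↔ x.IsSymm ∧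
    (∀ k l : Fin (r + 1), k < l → blk x l k ∈ V l k) ∧
    ∀ k : Fin (r + 1), ∃ c : ℝ, blk x k k = c • 1 := by
  simp only [Zspace, Set.mem_ofPred_eq, blk_diag_iff]

theorem Z_diag {x : Mat r n} (hx : x ∈ Zspace V) (k : Fin (r + 1)) :
    blk x k k = tdiag x k • 1 := by
  obtain ⟨t, ht⟩ := (mem_Zspace_iff.1 hx).2.2 k
  rw [tdiag_eq ht, ht]

theorem Z_symm {x : Mat r n} (hx : x ∈ Zspace V) (p q : Idx r n) : x p q = x q p :=
  hx.1.apply q p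

theorem one_mem_Z : (1 : Mat r n) ∈ Zspace V :=
  mem_Zspace_iff.2 ⟨Matrix.isSymm_one, fun k l h => by
    rw [blk_one_ne h.ne']; exact (V l k).zero_mem, fun k => ⟨1, by rw [blk_one_self, one_smul]⟩⟩

theorem lowT_apply_of_lt {T : Mat r n} (hT : T ∈ lowT V) {p q : Idx r n} (h : p.1 < q.1) :
    T p q = 0 := by
  have := congrFun (congrFun (hT.1 q.1 p.1 h) p.2) q.2
  simpa using this

theorem one_mem_lowT : (1 : Mat r n) ∈ lowT V :=
  ⟨fun k l h => blk_one_ne h.ne, fun k l h => by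
    rw [blk_one_ne h.ne']; exact (V l k).zero_mem, fun k => ⟨1, by rw [blk_one_self, one_smul]⟩⟩

theorem tdiag_one (k : Fin (r + 1)) : tdiag (1 : Mat r n) k = 1 := by
  simp [tdiag]

theorem one_mem_Hgrp : (1 : Mat r n) ∈ Hgrp V :=
  mem_Hgrp_iff.2 ⟨one_mem_lowT, fun k => by simp [tdiag_one]⟩

theorem blk_mul_self_of_lowT {T U : Mat r n} (hT : T ∈ lowT V) (hU : U ∈ lowT V)
    (k : Fin (r + 1)) : blk (T * U) k k = (tdiag T k * tdiag U k) • 1 := by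
  rw [blk_mul, Finset.sum_eq_single k]
  · rw [lowT_diag hT, lowT_diag hU, Matrix.smul_mul, Matrix.one_mul, smul_smul]
  · intro j _ hj
    rcases lt_or_gt_of_ne hj with h | h
    · rw [hU.1 k j h, Matrix.mul_zero]
    · rw [hT.1 j k h, Matrix.zero_mul]
  · simp

theorem lowT_mul (hV1 : CondV1 V) {T U : Mat r n} (hT : T ∈ lowT V) (hU : U ∈ lowT V) :
    T * U ∈ lowT V := by
  refine ⟨fun k l h => ?_, fun k l h => ?_, fun k => ⟨_, blk_mul_self_of_lowT hT hU k⟩⟩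
  · rw [blk_mul]
    refine Finset.sum_eq_zero fun j _ => ?_
    rcases lt_or_ge j k with h' | h'
    · rw [hU.1 k j h', Matrix.mul_zero]
    · rw [hT.1 j l (h.trans_le h'), Matrix.zero_mul]
  · rw [blk_mul]
    refine Submodule.sum_mem _ fun j _ => ?_
    rcases lt_trichotomy j k with h' | rfl | h'
    · rw [hU.1 k j h', Matrix.mul_zero]; exact zero_mem _
    · rw [lowT_diag hU, Matrix.mul_smul, Matrix.mul_one]
      exact Submodule.smul_mem _ _ (hT.2.1 _ _ h)
    rcases lt_trichotomy j l with h'' | rfl | h''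
    · exact hV1 k j l h' h'' _ (hT.2.1 _ _ h'') _ (hU.2.1 _ _ h')
    · rw [lowT_diag hT, Matrix.smul_mul, Matrix.one_mul]
      exact Submodule.smul_mem _ _ (hU.2.1 _ _ h)
    · rw [hT.1 j l h'', Matrix.zero_mul]; exact zero_mem _

theorem tdiag_mul {T U : Mat r n} (hT : T ∈ lowT V) (hU : U ∈ lowT V) (k : Fin (r + 1)) :
    tdiag (T * U) k = tdiag T k * tdiag U k :=
  tdiag_eq (blk_mul_self_of_lowT hT hU k)

theorem Hgrp_mul (hV1 : CondV1 V) {T U : Mat r n} (hT : T ∈ Hgrp V) (hU : U ∈ Hgrp V) :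
    T * U ∈ Hgrp V := by
  rw [mem_Hgrp_iff] at *
  exact ⟨lowT_mul hV1 hT.1 hU.1, fun k => by
    rw [tdiag_mul hT.1 hU.1]; exact mul_pos (hT.2 k) (hU.2 k)⟩

theorem chi_mul (s : Fin (r + 1) → ℝ) {T U : Mat r n} (hT : T ∈ Hgrp V) (hU : U ∈ Hgrp V) :
    chi s (T * U) = chi s T * chi s U := by
  rw [mem_Hgrp_iff] at hT hU
  simp only [chi, ← Finset.prod_mul_distrib]
  refine Finset.prod_congr rfl fun k _ => ?_
  rw [tdiag_mul hT.1 hU.1, Real.mul_rpow (hT.2 k).le (hU.2 k).le]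

theorem chi_pos (s : Fin (r + 1) → ℝ) {T : Mat r n} (hT : T ∈ Hgrp V) : 0 < chi s T :=
  Finset.prod_pos fun k _ => Real.rpow_pos_of_pos ((mem_Hgrp_iff.1 hT).2 k) _

theorem chi_add (s s' : Fin (r + 1) → ℝ) {T : Mat r n} (hT : T ∈ Hgrp V) :
    chi (s + s') T = chi s T * chi s' T := by
  simp only [chi, ← Finset.prod_mul_distrib]
  refine Finset.prod_congr rfl fun k _ => ?_
  rw [← Real.rpow_add ((mem_Hgrp_iff.1 hT).2 k), Pi.add_apply, mul_add]

theorem mul_transpose_mem_Z (hV2 : CondV2 V) (hV3 : CondV3 V) {T : Mat r n} (hT : T ∈ lowT V) :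
    T * Tᵀ ∈ Zspace V := by
  refine mem_Zspace_iff.2 ⟨Matrix.isSymm_mul_transpose_self T, fun k l h => ?_, fun k => ?_⟩
  · rw [blk_mul]
    refine Submodule.sum_mem _ fun j _ => ?_
    rw [blk_transpose]
    rcases lt_trichotomy j k with h' | rfl | h'
    · exact hV2 j k l h' h _ (hT.2.1 _ _ (h'.trans h)) _ (hT.2.1 _ _ h')
    · rw [lowT_diag hT, Matrix.transpose_smul, Matrix.transpose_one, Matrix.mul_smul,
        Matrix.mul_one]
      exact Submodule.smul_mem _ _ (hT.2.1 _ _ h)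
    · rw [hT.1 j k h', Matrix.transpose_zero, Matrix.mul_zero]; exact zero_mem _
  · have : ∀ j, ∃ c : ℝ, blk T k j * blk Tᵀ j k = c • 1 := by
      intro j
      rw [blk_transpose]
      rcases lt_trichotomy j k with h' | rfl | h'
      · exact hV3 j k h' _ (hT.2.1 _ _ h')
      · exact ⟨tdiag T j * tdiag T j, by
          rw [lowT_diag hT, Matrix.transpose_smul, Matrix.transpose_one, Matrix.mul_smul,
            Matrix.smul_mul, Matrix.mul_one, smul_smul]⟩
      · exact ⟨0, by rw [hT.1 j k h', Matrix.zero_mul, zero_smul]⟩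
    choose c hc using this
    exact ⟨∑ j, c j, by rw [blk_mul, Finset.sum_smul]; exact Finset.sum_congr rfl fun j _ => hc j⟩

theorem det_of_blockTriangular {κ : Type*} [Fintype κ] [LinearOrder κ] {α : κ → Type*}
    [∀ k, Fintype (α k)] [∀ k, DecidableEq (α k)]
    (M : Matrix (Σ k, α k) (Σ k, α k) ℝ) (t : κ → ℝ)
    (h0 : ∀ p q, q.1 < p.1 → M p q = 0)
    (hd : ∀ k a b, M ⟨k, a⟩ ⟨k, b⟩ = if a = b then t k else 0) :
    M.det = ∏ k, t k ^ Fintype.card (α k) := by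
  have hM : M.BlockTriangular Sigma.fst := fun p q h => h0 p q h
  rw [hM.det_fintype]
  refine Finset.prod_congr rfl fun k _ => ?_
  have : M.toSquareBlock Sigma.fst k = t k • 1 := by
    ext ⟨⟨i, a⟩, hi⟩ ⟨⟨j, b⟩, hj⟩
    simp only at hi hj
    subst hi
    subst hj
    simp [Matrix.toSquareBlock_def, hd, Matrix.one_apply]
  rw [this, Matrix.det_smul, Matrix.det_one, mul_one, Fintype.card_congr (Equiv.sigmaSubtype k)]

theorem Hgrp_posDef {T : Mat r n} (hT : T ∈ Hgrp V) : (T * Tᵀ).PosDef := by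
  rw [mem_Hgrp_iff] at hT
  have hdet : Tᵀ.det = ∏ k, tdiag T k ^ Fintype.card (Fin (n k)) := by
    refine det_of_blockTriangular _ _ (fun p q h => ?_) fun k a b => ?_
    · exact lowT_apply_of_lt hT.1 h
    · rw [Matrix.transpose_apply, blk_diag_iff.2 (lowT_diag hT.1 k) b a]
      simp [eq_comm]
  have := Matrix.PosDef.mul_conjTranspose_self T (Matrix.vecMul_injective_iff_isUnit.2 (by
    rw [Matrix.isUnit_iff_isUnit_det, ← Matrix.det_transpose, hdet, isUnit_iff_ne_zero]
    exact (Finset.prod_pos fun k _ => pow_pos (hT.2 k) _).ne'))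
  rwa [Matrix.conjTranspose_eq_transpose_of_trivial] at this

theorem rhoM_one (T : Mat r n) : rhoM T 1 = T * Tᵀ := by
  rw [rhoM, Matrix.mul_one]

theorem rhoM_mem_Pcone (hV2 : CondV2 V) (hV3 : CondV3 V) {T : Mat r n} (hT : T ∈ Hgrp V) :
    T * Tᵀ ∈ Pcone V :=
  ⟨mul_transpose_mem_Z hV2 hV3 (mem_Hgrp_iff.1 hT).1, Hgrp_posDef hT⟩

theorem sum_ite_block (k : Fin (r + 1)) (f : Idx r n → ℝ) :
    ∑ q, (if q.1 = k then f q else 0) = ∑ a, f ⟨k, a⟩ := by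
  rw [Fintype.sum_sigma, Finset.sum_eq_single k]
  · simp
  · intro j _ hj
    simp [hj]
  · simp

theorem schur_quadratic {Y : Mat r n} (hY : Y.IsSymm) {k : Fin (r + 1)} {c : ℝ} (hc : 0 < c)
    (hk : ∀ a b : Fin (n k), Y ⟨k, a⟩ ⟨k, b⟩ = if a = b then c else 0)
    (v : Idx r n → ℝ)
    (C : Mat r n) (hC : ∀ p q, C p q = if q.1 = k then Y p q / √c else 0) :
    ∃ u : Idx r n → ℝ, (∀ p, p.1 ≠ k → u p = v p) ∧
      v ⬝ᵥ (Y - C * Cᵀ) *ᵥ v = u ⬝ᵥ Y *ᵥ u := by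
  set w := Y *ᵥ v with hw
  set u : Idx r n → ℝ := fun p => if p.1 = k then -(w p) / c else 0 with hu
  set W := ∑ a, w ⟨k, a⟩ ^ 2 with hW
  have h1 : u ⬝ᵥ w = -W / c := by
    have : u ⬝ᵥ w = ∑ p, (if p.1 = k then -(w p) / c * w p else 0) := by
      simp only [dotProduct, hu, ite_mul, zero_mul]
    rw [this, sum_ite_block k fun p => -(w p) / c * w p, hW, ← Finset.sum_neg_distrib,
      Finset.sum_div]
    exact Finset.sum_congr rfl fun a _ => by ring
  have h2 : ∀ a, (Y *ᵥ u) ⟨k, a⟩ = -w ⟨k, a⟩ := by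
    intro a
    have : (Y *ᵥ u) ⟨k, a⟩ = ∑ q, (if q.1 = k then Y ⟨k, a⟩ q * (-(w q) / c) else 0) := by
      simp only [Matrix.mulVec, dotProduct, hu, mul_ite, mul_zero]
    rw [this, sum_ite_block k fun q => Y ⟨k, a⟩ q * (-(w q) / c)]
    simp only [hk, ite_mul, zero_mul, Finset.sum_ite_eq, Finset.mem_univ, if_true]
    field_simp
  have h3 : u ⬝ᵥ Y *ᵥ u = W / c := by
    have : u ⬝ᵥ Y *ᵥ u = ∑ p, (if p.1 = k then -(w p) / c * (Y *ᵥ u) p else 0) := by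
      simp only [dotProduct, hu, ite_mul, zero_mul]
    rw [this, sum_ite_block k fun p => -(w p) / c * (Y *ᵥ u) p, hW, Finset.sum_div]
    exact Finset.sum_congr rfl fun a _ => by rw [h2]; ring
  have h4 : v ⬝ᵥ Y *ᵥ u = u ⬝ᵥ w := by
    rw [dotProduct_comm, hw, Matrix.dotProduct_mulVec, ← Matrix.mulVec_transpose, hY.eq,
      dotProduct_comm, Matrix.dotProduct_mulVec, ← Matrix.mulVec_transpose, hY.eq,
      dotProduct_comm]
  have h5 : v ⬝ᵥ (C * Cᵀ) *ᵥ v = W / c := by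
    rw [← Matrix.mulVec_mulVec, Matrix.dotProduct_mulVec, ← Matrix.mulVec_transpose]
    have hCv : ∀ q, (Cᵀ *ᵥ v) q = if q.1 = k then w q / √c else 0 := by
      intro q
      simp only [Matrix.mulVec, dotProduct, Matrix.transpose_apply, hC, hw]
      split_ifs
      · rw [Finset.sum_div]
        exact Finset.sum_congr rfl fun p _ => by rw [hY.apply p q]; ring
      · simp
    have : Cᵀ *ᵥ v ⬝ᵥ Cᵀ *ᵥ v = ∑ p, (if p.1 = k then w p ^ 2 / c else 0) := by
      simp only [dotProduct, hCv]
      refine Finset.sum_congr rfl fun p _ => ?_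
      split_ifs
      · rw [div_mul_div_comm, Real.mul_self_sqrt hc.le, sq]
      · simp
    rw [this, sum_ite_block k fun p => w p ^ 2 / c, hW, Finset.sum_div]
  refine ⟨v + u, fun p hp => by simp [hu, hp], ?_⟩
  rw [Matrix.sub_mulVec, dotProduct_sub, h5, Matrix.mulVec_add, dotProduct_add, add_dotProduct,
    add_dotProduct, h4, h3, ← hw, h1]
  ring

theorem exists_partial_cholesky (hV2 : CondV2 V) (hV3 : CondV3 V) {θ : Mat r n}
    (hθ : θ ∈ Pcone V) (m : ℕ) (hm : m ≤ r + 1) :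
    ∃ T ∈ lowT V, (∀ k : Fin (r + 1), (k : ℕ) < m → 0 < tdiag T k) ∧
      (∀ p q : Idx r n, m ≤ (q.1 : ℕ) → T p q = 0) ∧
      (∀ p q : Idx r n, (p.1 : ℕ) < m → (θ - T * Tᵀ) p q = 0) ∧
      ∀ v : Idx r n → ℝ, (∀ p, (p.1 : ℕ) < m → v p = 0) → v ≠ 0 →
        0 < v ⬝ᵥ (θ - T * Tᵀ) *ᵥ v := by
  induction m with
  | zero =>
    refine ⟨0, zero_mem _, by simp, by simp, by simp, fun v _ hv => ?_⟩
    have := hθ.2.dotProduct_mulVec_pos hv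
    simpa using this
  | succ m ih =>
    obtain ⟨T, hT, hpos, hcol, hrow, hquad⟩ := ih (by omega)
    set k : Fin (r + 1) := ⟨m, by omega⟩ with hk
    set Y := θ - T * Tᵀ with hY
    have hYZ : Y ∈ Zspace V := (Zsub V).sub_mem hθ.1 (mul_transpose_mem_Z hV2 hV3 hT)
    have hYk := Z_diag hYZ k
    set c := tdiag Y k with hc
    have hYk' := blk_diag_iff.2 hYk
    have hc0 : 0 < c := by
      have := hquad (Pi.single ⟨k, ⟨0, (n k).2⟩⟩ 1) (fun p hp => by
        rw [Pi.single_eq_of_ne]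
        rintro rfl
        simp [hk] at hp) (by simp)
      simp only [Matrix.mulVec_single_one, single_one_dotProduct, Matrix.col_apply] at this
      exact this
    have hs0 : 0 < √c := Real.sqrt_pos.2 hc0
    set C : Mat r n := Matrix.of fun p q => if q.1 = k then Y p q / √c else 0 with hCdef
    have hC : ∀ p q, C p q = if q.1 = k then Y p q / √c else 0 := fun p q => rfl
    have hblkC : ∀ l, blk C l k = (√c)⁻¹ • blk Y l k := by
      intro l
      ext a b
      simp [hC, div_eq_inv_mul]
    have hblkC' : ∀ l j, j ≠ k → blk C l j = 0 := by
      intro l j hj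
      ext a b
      simp [hC, hj]
    have hCk : blk C k k = √c • 1 := by
      rw [hblkC, hYk, smul_smul]
      congr 1
      field_simp
      rw [Real.sq_sqrt hc0.le]
    have hCT : C ∈ lowT V := by
      refine ⟨fun j l h => ?_, fun j l h => ?_, fun j => ?_⟩
      · by_cases hj : j = k
        · rw [hj, hblkC]
          have : blk Y l k = 0 := by
            ext a b
            exact hrow _ _ (by rw [hj] at h; exact h)
          rw [this, smul_zero]
        · exact hblkC' l j hj
      · by_cases hj : j = k
        · rw [hj, hblkC]
          exact Submodule.smul_mem _ _ ((mem_Zspace_iff.1 hYZ).2.1 _ _ (hj ▸ h))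
        · rw [hblkC' l j hj]; exact zero_mem _
      · by_cases hj : j = k
        · exact ⟨√c, by rw [hj, hCk]⟩
        · exact ⟨0, by rw [hblkC' j j hj, zero_smul]⟩
    have hcross : T * Cᵀ = 0 := by
      ext p q
      rw [Matrix.mul_apply]
      refine Finset.sum_eq_zero fun j _ => ?_
      rw [Matrix.transpose_apply, hC]
      split_ifs with hj
      · rw [hcol p j (by rw [hj]), zero_mul]
      · rw [mul_zero]
    have hcross' : C * Tᵀ = 0 := by
      rw [← Matrix.transpose_transpose C, ← Matrix.transpose_mul, hcross, Matrix.transpose_zero]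
    have hexp : θ - (T + C) * (T + C)ᵀ = Y - C * Cᵀ := by
      rw [Matrix.transpose_add, Matrix.add_mul, Matrix.mul_add, Matrix.mul_add, hcross, hcross',
        hY]
      abel
    have hCC : ∀ p q, (C * Cᵀ) p q = ∑ a, Y p ⟨k, a⟩ * Y q ⟨k, a⟩ / c := by
      intro p q
      have : (C * Cᵀ) p q = ∑ j, (if j.1 = k then Y p j * Y q j / c else 0) := by
        rw [Matrix.mul_apply]
        refine Finset.sum_congr rfl fun j _ => ?_
        rw [Matrix.transpose_apply, hC, hC]
        split_ifs
        · rw [div_mul_div_comm, Real.mul_self_sqrt hc0.le]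
        · simp
      rw [this, sum_ite_block k fun j => Y p j * Y q j / c]
    refine ⟨T + C, add_mem hT hCT, fun j hj => ?_, fun p q hq => ?_, fun p q hp => ?_,
      fun v hv hv0 => ?_⟩
    · by_cases hjk : j = k
      · have : tdiag (T + C) j = √c := by
          refine tdiag_eq ?_
          rw [blk_add, hjk, hCk]
          ext a b
          simp [hcol ⟨k, a⟩ ⟨k, b⟩ (le_of_eq rfl)]
        rw [this]
        exact hs0
      · have h1 : tdiag (T + C) j = tdiag T j := by
          simp [tdiag, hC, hjk]
        rw [h1]
        refine hpos j ?_
        have : (j : ℕ) ≠ m := fun h => hjk (Fin.ext h)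
        omega
    · have hqk : q.1 ≠ k := fun h => by rw [h] at hq; simp [hk] at hq
      rw [Matrix.add_apply, hC, if_neg hqk, hcol p q (by omega), add_zero]
    · rw [hexp, Matrix.sub_apply, hCC]
      by_cases hpk : p.1 = k
      · obtain ⟨j, b⟩ := p
        simp only at hpk
        subst hpk
        simp only [hYk', ite_mul, zero_mul, ite_div, zero_div, Finset.sum_ite_eq,
          Finset.mem_univ, if_true]
        rw [mul_div_cancel_left₀ _ hc0.ne', Z_symm hYZ, sub_self]
      · have hpm : (p.1 : ℕ) < m := by
          have : (p.1 : ℕ) ≠ m := fun h => hpk (Fin.ext h)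
          omega
        rw [hrow p q hpm, Finset.sum_eq_zero, sub_self]
        intro a _
        rw [hrow p _ hpm, zero_mul, zero_div]
    · rw [hexp]
      obtain ⟨u, hu, huv⟩ := schur_quadratic hYZ.1 hc0 hYk' v C hC
      rw [huv]
      refine hquad u (fun p hp => ?_) ?_
      · have hpk : p.1 ≠ k := fun h => by rw [h] at hp; simp [hk] at hp
        rw [hu p hpk, hv p (by omega)]
      · rintro rfl
        refine hv0 (funext fun p => ?_)
        by_cases hpk : p.1 = k
        · exact hv p (by rw [hpk]; simp [hk])
        · rw [← hu p hpk]

theorem exists_cholesky (hV2 : CondV2 V) (hV3 : CondV3 V) {θ : Mat r n}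
    (hθ : θ ∈ Pcone V) : ∃ T ∈ Hgrp V, θ = T * Tᵀ := by
  obtain ⟨T, hT, hpos, -, hrow, -⟩ := exists_partial_cholesky hV2 hV3 hθ (r + 1) le_rfl
  refine ⟨T, mem_Hgrp_iff.2 ⟨hT, fun k => hpos k k.2⟩, ?_⟩
  rw [← sub_eq_zero]
  ext p q
  exact hrow p q p.1.2

instance {m n : Type*} [Fintype m] [Fintype n] : BorelSpace (Matrix m n ℝ) :=
  inferInstanceAs (BorelSpace (m → n → ℝ))

/-- The squared Frobenius norm. -/
def fsq {m : Type*} [Fintype m] (M : Matrix m (Idx r n) ℝ) : ℝ := (M * Mᵀ).trace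

theorem fsq_eq {m : Type*} [Fintype m] (M : Matrix m (Idx r n) ℝ) :
    fsq M = ∑ a, ∑ q, M a q ^ 2 := by
  simp [fsq, Matrix.trace, Matrix.mul_apply, sq]

theorem fsq_nonneg {m : Type*} [Fintype m] (M : Matrix m (Idx r n) ℝ) : 0 ≤ fsq M := by
  rw [fsq_eq]; positivity

theorem fsq_smul {m : Type*} [Fintype m] (c : ℝ) (M : Matrix m (Idx r n) ℝ) :
    fsq (c • M) = c ^ 2 * fsq M := by
  simp only [fsq_eq, Matrix.smul_apply, smul_eq_mul, mul_pow, Finset.mul_sum]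

theorem tip_gram {m : Type*} [Fintype m] (T : Mat r n) (M : Matrix m (Idx r n) ℝ) :
    tip (T * Tᵀ) (Mᵀ * M) = fsq (M * T) := by
  rw [tip, fsq, Matrix.transpose_mul, ← Matrix.mul_assoc, Matrix.trace_mul_comm]
  simp only [Matrix.mul_assoc]

theorem tip_comm (x y : Mat r n) : tip x y = tip y x := Matrix.trace_mul_comm x y

theorem tip_add_right (x y z : Mat r n) : tip x (y + z) = tip x y + tip x z := by
  simp [tip, Matrix.mul_add]

theorem tip_sub_right (x y z : Mat r n) : tip x (y - z) = tip x y - tip x z := by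
  simp [tip, Matrix.mul_sub]

theorem tip_smul_right (c : ℝ) (x y : Mat r n) : tip x (c • y) = c * tip x y := by
  simp [tip]

theorem tip_add_left (x y z : Mat r n) : tip (x + y) z = tip x z + tip y z := by
  simp [tip, Matrix.add_mul]

theorem tip_smul_left (c : ℝ) (x y : Mat r n) : tip (c • x) y = c * tip x y := by
  simp [tip]

theorem tip_self_eq_zero {x : Mat r n} (hx : x.IsSymm) (h : tip x x = 0) : x = 0 := by
  have h1 : tip x x = ∑ p, ∑ q, x p q ^ 2 := by
    simp only [tip, Matrix.trace, Matrix.diag_apply, Matrix.mul_apply]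
    exact Finset.sum_congr rfl fun p _ => Finset.sum_congr rfl fun q _ => by
      rw [hx.apply p q, sq]
  rw [h1] at h
  ext p q
  have h2 := (Finset.sum_eq_zero_iff_of_nonneg fun p _ => by positivity).1 h p (Finset.mem_univ p)
  have h3 := (Finset.sum_eq_zero_iff_of_nonneg fun p _ => by positivity).1 h2 q
    (Finset.mem_univ q)
  simpa using h3

variable (V) in
theorem exists_proj : ∃ π : Mat r n →ₗ[ℝ] Mat r n, (∀ y, π y ∈ Zspace V) ∧
    ∀ θ ∈ Zspace V, ∀ y, tip θ (π y) = tip θ y := by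
  let B : LinearMap.BilinForm ℝ (Mat r n) := LinearMap.mk₂ ℝ tip tip_add_left tip_smul_left
    tip_add_right tip_smul_right
  have hB : ∀ x y, B x y = tip x y := fun _ _ => rfl
  have hrefl : B.IsRefl := fun x y h => by rw [hB, tip_comm]; exact h
  have hnd : (B.restrict (Zsub V)).Nondegenerate := by
    constructor
    · rintro ⟨x, hx⟩ h
      exact Subtype.ext (tip_self_eq_zero hx.1 (h ⟨x, hx⟩))
    · rintro ⟨x, hx⟩ h
      exact Subtype.ext (tip_self_eq_zero hx.1 (h ⟨x, hx⟩))
  have hc := B.isCompl_orthogonal_of_restrict_nondegenerate hrefl hnd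
  refine ⟨(Zsub V).projection _ hc, fun y => mem_Zsub.1 (Submodule.projection_apply_mem hc y),
    fun θ hθ y => ?_⟩
  have h1 : (Zsub V).projection _ hc (y - (Zsub V).projection _ hc y) = 0 := by
    rw [map_sub, Submodule.projection_apply_of_mem_left hc (Submodule.projection_apply_mem hc y),
      sub_self]
  have h2 : tip θ (y - (Zsub V).projection _ hc y) = 0 :=
    (Submodule.projection_apply_eq_zero_iff hc).1 h1 θ hθ
  rw [tip_sub_right] at h2
  linarith

variable (V) in
/-- The orthogonal projection onto `𝒵`. -/
noncomputable def projZ : Mat r n →ₗ[ℝ] Mat r n := (exists_proj V).choose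

theorem projZ_mem (y : Mat r n) : projZ V y ∈ Zspace V := (exists_proj V).choose_spec.1 y

theorem tip_projZ {θ : Mat r n} (hθ : θ ∈ Zspace V) (y : Mat r n) :
    tip θ (projZ V y) = tip θ y := (exists_proj V).choose_spec.2 θ hθ y

theorem continuous_tip (θ : Mat r n) : Continuous (tip θ) :=
  (continuous_const.matrix_mul continuous_id).matrix_trace

@[fun_prop]
theorem measurable_tip (θ : Mat r n) : Measurable (tip θ) := (continuous_tip θ).measurable

theorem measurable_of_linear {m₁ n₁ m₂ n₂ : Type*} [Fintype m₁] [Fintype n₁] [Fintype m₂]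
    [Fintype n₂] (f : Matrix m₁ n₁ ℝ →ₗ[ℝ] Matrix m₂ n₂ ℝ) : Measurable f :=
  (LinearMap.continuous_of_finiteDimensional f).measurable

variable (V) in
@[fun_prop]
theorem measurable_projZ : Measurable (projZ V) := measurable_of_linear _

variable (V) in
theorem isClosed_Zspace : IsClosed (Zspace V) := Submodule.closed_of_finiteDimensional (Zsub V)

variable (V) in
theorem measurableSet_Zspace : MeasurableSet (Zspace V) := (isClosed_Zspace V).measurableSet

theorem laplace_map {X : Type*} [MeasurableSpace X] {μ : Measure X} {f : X → Mat r n}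
    (hf : Measurable f) (θ : Mat r n) :
    laplace (μ.map f) θ = ∫⁻ x, ENNReal.ofReal (Real.exp (-(tip θ (f x)))) ∂μ :=
  lintegral_map (by fun_prop) hf

theorem withDensity_exp_neg {X : Type*} [MeasurableSpace X] {μ : Measure X} {g : X → ℝ}
    (hg : Measurable g) :
    (μ.withDensity fun x => ENNReal.ofReal (Real.exp (g x))).withDensity
      (fun x => ENNReal.ofReal (Real.exp (g x)))⁻¹ = μ :=
  withDensity_inv_same (by fun_prop) (.of_forall fun x => by simp [Real.exp_pos])
    (.of_forall fun x => ENNReal.ofReal_ne_top)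

theorem sFinite_of_laplace {μ : Measure (Mat r n)} {θ : Mat r n} (h : laplace μ θ ≠ ∞) :
    SFinite μ := by
  have h1 : IsFiniteMeasure
      (μ.withDensity fun x => ENNReal.ofReal (Real.exp (-(tip θ x)))) :=
    isFiniteMeasure_withDensity h
  rw [← withDensity_exp_neg (μ := μ) (g := fun x => -(tip θ x)) (by fun_prop)]
  infer_instance

theorem measure_eq_zero_of_tendsto {X : Type*} [MeasurableSpace X] {μ : Measure X} {g : X → ℝ}
    (hg : Measurable g) {A : Set X} {f : ℝ → ℝ}
    (hf : Filter.Tendsto f Filter.atTop (nhds 0))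
    (h : ∀ t ≥ 1, ∫⁻ x in A, ENNReal.ofReal (Real.exp (g x)) ∂μ ≤ ENNReal.ofReal (f t)) :
    μ A = 0 := by
  have h1 : ∫⁻ x in A, ENNReal.ofReal (Real.exp (g x)) ∂μ ≤ ENNReal.ofReal 0 :=
    ge_of_tendsto (ENNReal.tendsto_ofReal hf) (Filter.eventually_atTop.2 ⟨1, h⟩)
  rw [ENNReal.ofReal_zero, nonpos_iff_eq_zero, lintegral_eq_zero_iff (by fun_prop)] at h1
  have h2 : ∀ᵐ x ∂(μ.restrict A), False := by
    filter_upwards [h1] with x hx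
    simp at hx
    exact absurd hx (not_le.2 (Real.exp_pos _))
  rw [Filter.eventually_false_iff_eq_bot, ae_eq_bot, Measure.restrict_eq_zero] at h2
  exact h2

theorem ae_nonneg_of_growth {X : Type*} [MeasurableSpace X] {μ : Measure X} {g Y : X → ℝ}
    (hg : Measurable g) (hY : Measurable Y) {c σ : ℝ}
    (h : ∀ t ≥ 1, ∫⁻ x, ENNReal.ofReal (Real.exp (-(g x + t * Y x))) ∂μ ≤
      ENNReal.ofReal (c * t ^ σ)) : ∀ᵐ x ∂μ, 0 ≤ Y x := by
  have key : ∀ m : ℕ, ∀ᵐ x ∂μ, -(1 / ((m : ℝ) + 1)) ≤ Y x := by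
    intro m
    set δ : ℝ := 1 / ((m : ℝ) + 1) with hδ
    have hδ0 : 0 < δ := by positivity
    have hA : MeasurableSet {x | Y x < -δ} := measurableSet_lt hY measurable_const
    have h0 : μ {x | Y x < -δ} = 0 := by
      refine measure_eq_zero_of_tendsto (g := fun x => -(g x)) hg.neg
        (f := fun t => c * (t ^ σ * Real.exp (-δ * t))) ?_ ?_
      · simpa using (tendsto_rpow_mul_exp_neg_mul_atTop_nhds_zero σ δ hδ0).const_mul c
      · intro t ht
        have h1 : ∀ x ∈ {x | Y x < -δ}, ENNReal.ofReal (Real.exp (-(g x))) ≤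
            ENNReal.ofReal (Real.exp (-δ * t)) * ENNReal.ofReal (Real.exp (-(g x + t * Y x))) := by
          intro x hx
          have hx : Y x < -δ := hx
          rw [← ENNReal.ofReal_mul (Real.exp_pos _).le, ← Real.exp_add]
          exact ENNReal.ofReal_le_ofReal (Real.exp_le_exp.2 (by nlinarith))
        calc _ ≤ ∫⁻ x in {x | Y x < -δ}, ENNReal.ofReal (Real.exp (-δ * t)) *
              ENNReal.ofReal (Real.exp (-(g x + t * Y x))) ∂μ := setLIntegral_mono' hA h1
          _ ≤ ∫⁻ x, ENNReal.ofReal (Real.exp (-δ * t)) *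
              ENNReal.ofReal (Real.exp (-(g x + t * Y x))) ∂μ := setLIntegral_le_lintegral _ _
          _ ≤ ENNReal.ofReal (Real.exp (-δ * t)) * ENNReal.ofReal (c * t ^ σ) := by
            rw [lintegral_const_mul _ (by fun_prop)]
            gcongr
            exact h t ht
          _ = _ := by
            rw [← ENNReal.ofReal_mul (Real.exp_pos _).le]
            congr 1; ring
    filter_upwards [measure_eq_zero_iff_ae_notMem.1 h0] with x hx
    exact not_lt.1 hx
  filter_upwards [ae_all_iff.2 key] with x hx
  have h0 : Filter.Tendsto (fun m : ℕ => -(1 / ((m : ℝ) + 1))) Filter.atTop (nhds 0) := by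
    simpa using (tendsto_one_div_add_atTop_nhds_zero_nat (𝕜 := ℝ)).neg
  exact le_of_tendsto' h0 hx

theorem ae_pos_of_decay {X : Type*} [MeasurableSpace X] {μ : Measure X} {g Y : X → ℝ}
    (hg : Measurable g) (hY : Measurable Y) {c σ : ℝ} (hσ : 0 < σ)
    (h : ∀ t ≥ 1, ∫⁻ x, ENNReal.ofReal (Real.exp (-(g x + t * Y x))) ∂μ ≤
      ENNReal.ofReal (c * t ^ (-σ))) : ∀ᵐ x ∂μ, 0 < Y x := by
  have hA : MeasurableSet {x | Y x ≤ 0} := measurableSet_le hY measurable_const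
  have h0 : μ {x | Y x ≤ 0} = 0 := by
    refine measure_eq_zero_of_tendsto (g := fun x => -(g x)) hg.neg
      (f := fun t => c * t ^ (-σ)) ?_ ?_
    · simpa using (tendsto_rpow_neg_atTop hσ).const_mul c
    · intro t ht
      refine le_trans (setLIntegral_mono' hA fun x hx => ?_)
        ((setLIntegral_le_lintegral _ _).trans (h t ht))
      have hx : Y x ≤ 0 := hx
      exact ENNReal.ofReal_le_ofReal (Real.exp_le_exp.2 (by nlinarith))
  filter_upwards [measure_eq_zero_iff_ae_notMem.1 h0] with x hx
  exact not_le.1 hx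

variable (V) in
/-- `μ` lives on `𝒵` and has Laplace transform `C • Δ_{-s}`. -/
structure IsRiesz (μ : Measure (Mat r n)) (s : Fin (r + 1) → ℝ) (C : ℝ) : Prop where
  compl_eq_zero : μ (Zspace V)ᶜ = 0
  pos : 0 < C
  laplace_eq : ∀ T ∈ Hgrp V, laplace μ (T * Tᵀ) = ENNReal.ofReal (C * chi (-s) T)

namespace IsRiesz

variable {μ : Measure (Mat r n)} {s : Fin (r + 1) → ℝ} {C : ℝ}

theorem sFinite (h : IsRiesz V μ s C) : SFinite μ :=
  sFinite_of_laplace (θ := 1 * 1ᵀ) (by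
    rw [h.laplace_eq 1 one_mem_Hgrp]; exact ENNReal.ofReal_ne_top)

theorem ae_mem (h : IsRiesz V μ s C) : ∀ᵐ x ∂μ, x ∈ Zspace V :=
  mem_ae_iff.2 h.compl_eq_zero

end IsRiesz

theorem isRiesz_one_iff (hV2 : CondV2 V) (hV3 : CondV3 V)
    {Δf : (Fin (r + 1) → ℝ) → Mat r n → ℝ}
    (hΔ : ∀ s : Fin (r + 1) → ℝ, ∀ T ∈ Hgrp V, Δf s (rhoM T 1) = chi s T)
    {μ : Measure (Mat r n)} {s : Fin (r + 1) → ℝ} :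
    IsRiesz V μ s 1 ↔ μ (Zspace V)ᶜ = 0 ∧
      ∀ θ ∈ Pcone V, laplace μ θ = ENNReal.ofReal (Δf (-s) θ) := by
  constructor
  · intro h
    refine ⟨h.compl_eq_zero, fun θ hθ => ?_⟩
    obtain ⟨T, hT, rfl⟩ := exists_cholesky hV2 hV3 hθ
    rw [h.laplace_eq T hT, ← rhoM_one, hΔ _ T hT, one_mul]
  · rintro ⟨h1, h2⟩
    refine ⟨h1, one_pos, fun T hT => ?_⟩
    rw [h2 _ (rhoM_mem_Pcone hV2 hV3 hT), ← rhoM_one, hΔ _ T hT, one_mul]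

theorem sqrt_smul_mul_transpose {c : ℝ} (hc : 0 ≤ c) (T : Mat r n) :
    (√c • T) * (√c • T)ᵀ = c • (T * Tᵀ) := by
  rw [Matrix.transpose_smul, Matrix.smul_mul, Matrix.mul_smul, smul_smul, Real.mul_self_sqrt hc]

theorem smul_mem_Hgrp {c : ℝ} (hc : 0 < c) {T : Mat r n} (hT : T ∈ Hgrp V) : c • T ∈ Hgrp V := by
  rw [mem_Hgrp_iff] at *
  exact ⟨(lowT V).smul_mem c hT.1, fun k => by
    simpa [tdiag] using mul_pos hc (hT.2 k)⟩

theorem chi_smul (s : Fin (r + 1) → ℝ) {c : ℝ} (hc : 0 < c) {T : Mat r n} (hT : T ∈ Hgrp V) :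
    chi s (c • T) = c ^ (2 * ∑ k, s k) * chi s T := by
  rw [Finset.mul_sum, Real.rpow_sum_of_pos hc, chi, chi, ← Finset.prod_mul_distrib]
  refine Finset.prod_congr rfl fun k _ => ?_
  rw [← Real.mul_rpow hc.le ((mem_Hgrp_iff.1 hT).2 k).le]
  rfl

theorem isClosed_posSemidef : IsClosed {x : Mat r n | x.PosSemidef} := by
  simp only [Matrix.posSemidef_iff_dotProduct_mulVec, Set.ofPred_and, Set.ofPred_forall]
  refine IsClosed.inter ?_ (isClosed_iInter fun v => ?_)
  · exact isClosed_eq (continuous_id.matrix_conjTranspose) continuous_id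
  · refine isClosed_le continuous_const ?_
    exact continuous_const.dotProduct (continuous_id.matrix_mulVec continuous_const)

theorem mem_closure_Qcone {x : Mat r n} (hx : x ∈ Zspace V) (h : ∀ θ ∈ Pcone V, 0 ≤ tip θ x) :
    x ∈ closure (Qcone V) := by
  have hQ : ∀ ε : ℝ, 0 < ε → x + ε • 1 ∈ Qcone V := by
    intro ε hε
    refine ⟨(Zsub V).add_mem hx ((Zsub V).smul_mem ε one_mem_Z), fun z hz hz0 => ?_⟩
    have h1 : 0 ≤ tip x z := by
      have hc : IsClosed {z | 0 ≤ tip x z} := isClosed_le continuous_const (continuous_tip x)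
      exact closure_minimal (fun θ hθ => by rw [Set.mem_ofPred_eq, tip_comm]; exact h θ hθ) hc hz
    have h2 : z.PosSemidef :=
      closure_minimal (fun θ hθ => hθ.2.posSemidef) isClosed_posSemidef hz
    have h3 : 0 < z.trace := h2.trace_nonneg.lt_of_ne fun h0 => hz0 (h2.trace_eq_zero_iff.1 h0.symm)
    rw [tip_add_left, tip_smul_left]
    have h4 : tip 1 z = z.trace := by simp [tip]
    rw [h4]
    positivity
  have hlim : Filter.Tendsto (fun ε : ℝ => x + ε • (1 : Mat r n)) (nhdsWithin 0 (Set.Ioi 0))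
      (nhds x) := by
    have : Continuous fun ε : ℝ => x + ε • (1 : Mat r n) := by fun_prop
    simpa using (this.tendsto 0).mono_left nhdsWithin_le_nhds
  exact mem_closure_of_tendsto hlim (Filter.eventually_of_mem self_mem_nhdsWithin hQ)

instance {m n : Type*} [Fintype m] [Fintype n] : SecondCountableTopology (Matrix m n ℝ) :=
  inferInstanceAs (SecondCountableTopology (m → n → ℝ))

namespace IsRiesz

variable {μ : Measure (Mat r n)} {s : Fin (r + 1) → ℝ} {C : ℝ}

theorem ae_tip_nonneg (h : IsRiesz V μ s C) {T : Mat r n} (hT : T ∈ Hgrp V) :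
    ∀ᵐ x ∂μ, 0 ≤ tip (T * Tᵀ) x := by
  refine ae_nonneg_of_growth (g := fun _ => 0) measurable_const (measurable_tip _)
    (c := C * chi (-s) T) (σ := ∑ k, (-s) k) fun t ht => ?_
  have ht0 : 0 < t := one_pos.trans_le ht
  have h1 := h.laplace_eq _ (smul_mem_Hgrp (Real.sqrt_pos.2 ht0) hT)
  rw [sqrt_smul_mul_transpose ht0.le, chi_smul _ (Real.sqrt_pos.2 ht0) hT, laplace] at h1
  simp only [tip_smul_left] at h1
  simp only [zero_add, h1]
  rw [Real.rpow_mul (Real.sqrt_nonneg t), Real.rpow_two, Real.sq_sqrt ht0.le]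
  exact (congrArg _ (by ring)).le

theorem support (hV2 : CondV2 V) (hV3 : CondV3 V) (h : IsRiesz V μ s C) :
    μ (closure (Qcone V))ᶜ = 0 := by
  have hne : Nonempty (Pcone V) := ⟨⟨_, rhoM_mem_Pcone hV2 hV3 one_mem_Hgrp⟩⟩
  have h1 : ∀ i : ℕ, ∀ᵐ x ∂μ, 0 ≤ tip (TopologicalSpace.denseSeq (Pcone V) i : Mat r n) x := by
    intro i
    obtain ⟨T, hT, hE⟩ := exists_cholesky hV2 hV3 (TopologicalSpace.denseSeq (Pcone V) i).2
    rw [hE]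
    exact h.ae_tip_nonneg hT
  refine mem_ae_iff.1 ?_
  filter_upwards [ae_all_iff.2 h1, h.ae_mem] with x hx hxZ
  refine mem_closure_Qcone hxZ fun θ hθ => ?_
  have hc : IsClosed {θ : Pcone V | 0 ≤ tip θ x} := by
    simp only [tip_comm _ x]
    exact isClosed_le continuous_const ((continuous_tip x).comp continuous_subtype_val)
  have h2 := closure_minimal (s := Set.range (TopologicalSpace.denseSeq (Pcone V)))
    (by rintro _ ⟨i, rfl⟩; exact hx i) hc
  exact h2 (TopologicalSpace.denseRange_denseSeq (Pcone V) ⟨θ, hθ⟩)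

end IsRiesz

/-- The matrix with diagonal blocks `t k • 1`. -/
def diagT (t : Fin (r + 1) → ℝ) : Mat r n := Matrix.diagonal fun p => t p.1

theorem diagT_mem_lowT (t : Fin (r + 1) → ℝ) : (diagT t : Mat r n) ∈ lowT V := by
  refine ⟨fun k l h => ?_, fun k l h => ?_, fun k => ⟨t k, ?_⟩⟩
  · ext a b; simp [diagT, h.ne]
  · have : blk (diagT t : Mat r n) l k = 0 := by ext a b; simp [diagT, h.ne']
    rw [this]; exact zero_mem _
  · ext a b; simp [diagT, Matrix.diagonal_apply, Matrix.one_apply]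

theorem tdiag_diagT (t : Fin (r + 1) → ℝ) (k : Fin (r + 1)) :
    tdiag (diagT t : Mat r n) k = t k := by simp [tdiag, diagT]

theorem diagT_mem_Hgrp {t : Fin (r + 1) → ℝ} (ht : ∀ k, 0 < t k) :
    (diagT t : Mat r n) ∈ Hgrp V :=
  mem_Hgrp_iff.2 ⟨diagT_mem_lowT t, fun k => by rw [tdiag_diagT]; exact ht k⟩

theorem diagT_mul (t u : Fin (r + 1) → ℝ) :
    (diagT t * diagT u : Mat r n) = diagT (t * u) := by
  simp [diagT]

theorem diagT_transpose (t : Fin (r + 1) → ℝ) : (diagT t : Mat r n)ᵀ = diagT t := by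
  simp [diagT]

theorem tip_diagT {x : Mat r n} (hx : x ∈ Zspace V) (t : Fin (r + 1) → ℝ) :
    tip (diagT t) x = ∑ k, t k * n k * tdiag x k := by
  simp only [tip, diagT, Matrix.trace, Matrix.diag_apply, Matrix.diagonal_mul, Fintype.sum_sigma]
  refine Finset.sum_congr rfl fun k _ => ?_
  have h : ∀ a : Fin (n k), x ⟨k, a⟩ ⟨k, a⟩ = tdiag x k := fun a => by
    simpa using congrFun (congrFun (Z_diag hx k) a) a
  simp only [h, Finset.sum_const, Finset.card_univ, Fintype.card_fin, nsmul_eq_mul]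
  ring

theorem ae_eq_zero_of_lintegral_exp {X : Type*} [MeasurableSpace X] {μ : Measure X} {g Y : X → ℝ}
    (hg : Measurable g) (hY : Measurable Y) {K : ℝ≥0∞} (hK : K ≠ ∞)
    (h : ∀ t : ℝ, 0 < t → ∫⁻ x, ENNReal.ofReal (Real.exp (-(g x + t * Y x))) ∂μ = K) :
    ∀ᵐ x ∂μ, Y x = 0 := by
  have e : ∀ x, ENNReal.ofReal (Real.exp (-(g x + 1 * Y x))) +
      ENNReal.ofReal (Real.exp (-(g x + 3 * Y x))) =
      ENNReal.ofReal (Real.exp (-(g x + 2 * Y x))) + ENNReal.ofReal (Real.exp (-(g x + 2 * Y x))) +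
      ENNReal.ofReal (Real.exp (-(g x + 1 * Y x)) * (1 - Real.exp (-Y x)) ^ 2) := by
    intro x
    rw [← ENNReal.ofReal_add (by positivity) (by positivity),
      ← ENNReal.ofReal_add (by positivity) (by positivity),
      ← ENNReal.ofReal_add (by positivity) (by positivity)]
    have h2 : Real.exp (-(g x + 2 * Y x)) = Real.exp (-(g x + 1 * Y x)) * Real.exp (-Y x) := by
      rw [← Real.exp_add]; ring_nf
    have h3 : Real.exp (-(g x + 3 * Y x)) =
        Real.exp (-(g x + 1 * Y x)) * Real.exp (-Y x) * Real.exp (-Y x) := by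
      rw [← Real.exp_add, ← Real.exp_add]; ring_nf
    rw [h2, h3]
    congr 1; ring
  have e2 := lintegral_congr (μ := μ) e
  rw [lintegral_add_left (by fun_prop), lintegral_add_left (by fun_prop),
    lintegral_add_left (by fun_prop), h 1 one_pos, h 2 two_pos, h 3 three_pos] at e2
  have e3 : ∫⁻ x, ENNReal.ofReal (Real.exp (-(g x + 1 * Y x)) * (1 - Real.exp (-Y x)) ^ 2) ∂μ =
      0 := by
    have : (K + K) + 0 = (K + K) +
      ∫⁻ x, ENNReal.ofReal (Real.exp (-(g x + 1 * Y x)) * (1 - Real.exp (-Y x)) ^ 2) ∂μ := by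
      rw [add_zero]; exact e2
    exact ((ENNReal.add_right_inj (ENNReal.add_ne_top.2 ⟨hK, hK⟩)).1 this).symm
  rw [lintegral_eq_zero_iff (by fun_prop)] at e3
  filter_upwards [e3] with x hx
  rw [Pi.zero_apply, ENNReal.ofReal_eq_zero] at hx
  have h1 : (1 - Real.exp (-Y x)) ^ 2 = 0 := by
    refine le_antisymm ?_ (sq_nonneg _)
    by_contra hn
    exact absurd hx (not_le.2 (mul_pos (Real.exp_pos _) (not_le.1 hn)))
  have h2 : Real.exp (-Y x) = 1 := by
    have := pow_eq_zero_iff (two_ne_zero) |>.1 h1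
    linarith
  simpa using h2

theorem blk_diagT_mul_mul (t u : Fin (r + 1) → ℝ) (M : Mat r n) (l k : Fin (r + 1)) :
    blk (diagT t * M * diagT u) l k = (t l * u k) • blk M l k := by
  ext a b
  simp [diagT]
  ring

theorem diagT_lowT_diagT {T : Mat r n} (hT : T ∈ lowT V) (t u : Fin (r + 1) → ℝ) :
    diagT t * T * diagT u ∈ lowT V := by
  refine ⟨fun k l h => ?_, fun k l h => ?_, fun k => ⟨t k * u k * tdiag T k, ?_⟩⟩
  · rw [blk_diagT_mul_mul, hT.1 k l h, smul_zero]
  · rw [blk_diagT_mul_mul]; exact Submodule.smul_mem _ _ (hT.2.1 k l h)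
  · rw [blk_diagT_mul_mul, lowT_diag hT, smul_smul]

theorem tdiag_diagT_mul_mul (T : Mat r n) (t u : Fin (r + 1) → ℝ) (k : Fin (r + 1)) :
    tdiag (diagT t * T * diagT u) k = t k * u k * tdiag T k := by
  exact congrFun (congrFun (blk_diagT_mul_mul t u T k k) ⟨0, (n k).2⟩) ⟨0, (n k).2⟩

theorem diagT_Z_diagT {x : Mat r n} (hx : x ∈ Zspace V) (t : Fin (r + 1) → ℝ) :
    diagT t * x * diagT t ∈ Zspace V := by
  rw [mem_Zspace_iff]
  refine ⟨?_, fun k l h => ?_, fun k => ⟨t k * t k * tdiag x k, ?_⟩⟩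
  · rw [Matrix.IsSymm, Matrix.transpose_mul, Matrix.transpose_mul, diagT_transpose, hx.1,
      Matrix.mul_assoc]
  · rw [blk_diagT_mul_mul]; exact Submodule.smul_mem _ _ (hx.2.1 k l h)
  · rw [blk_diagT_mul_mul, Z_diag hx, smul_smul]

/-- The indicator of the first `m` indices. -/
def below (m : ℕ) (k : Fin (r + 1)) : ℝ := if k.1 < m then 1 else 0

theorem below_mul_self (m : ℕ) : (below m * below m : Fin (r + 1) → ℝ) = below m := by
  ext k; simp [below]

theorem below_mul_compl (m : ℕ) : (below m * (1 - below m) : Fin (r + 1) → ℝ) = 0 := by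
  ext k; by_cases hk : k.1 < m <;> simp [below, hk]

/-- Restriction of a matrix to the blocks with indices `< m`. -/
def trunc (m : ℕ) (x : Mat r n) : Mat r n := diagT (below m) * x * diagT (below m)

theorem trunc_trunc (m : ℕ) (x : Mat r n) : trunc m (trunc m x) = trunc m x := by
  calc _ = (diagT (below m) * diagT (below m)) * x * (diagT (below m) * diagT (below m)) := by
        simp only [trunc, Matrix.mul_assoc]
    _ = _ := by rw [diagT_mul, below_mul_self, trunc]

theorem trunc_apply (m : ℕ) (x : Mat r n) (p q : Idx r n) :
    trunc m x p q = if p.1.1 < m ∧ q.1.1 < m then x p q else 0 := by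
  simp [trunc, diagT, below, ite_and]
  split_ifs <;> rfl

theorem continuous_trunc (m : ℕ) : Continuous (trunc m : Mat r n → Mat r n) :=
  (continuous_const.matrix_mul continuous_id).matrix_mul continuous_const

@[fun_prop]
theorem measurable_trunc (m : ℕ) : Measurable (trunc m : Mat r n → Mat r n) :=
  (continuous_trunc m).measurable

theorem tip_trunc (m : ℕ) (θ x : Mat r n) : tip θ (trunc m x) = tip (trunc m θ) x := by
  simp only [tip, trunc]
  rw [← Matrix.mul_assoc, Matrix.trace_mul_comm, ← Matrix.mul_assoc, ← Matrix.mul_assoc]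

theorem diagT_below_mul {T : Mat r n} (hT : T ∈ lowT V) (m : ℕ) :
    diagT (below m) * T = trunc m T := by
  ext p q
  rw [trunc_apply]
  simp only [diagT, below, Matrix.diagonal_mul]
  by_cases h1 : p.1.1 < m
  · by_cases h2 : q.1.1 < m
    · simp [h1, h2]
    · rw [lowT_apply_of_lt hT (p := p) (q := q) (Fin.lt_def.2 (by omega))]
      simp
  · simp [h1]

theorem trunc_mul_transpose {T : Mat r n} (hT : T ∈ lowT V) (m : ℕ) :
    trunc m (T * Tᵀ) = trunc m T * (trunc m T)ᵀ := by
  rw [← diagT_below_mul hT, Matrix.transpose_mul, diagT_transpose, trunc]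
  simp only [Matrix.mul_assoc]

theorem IsRiesz.map_trunc {μ : Measure (Mat r n)} {s : Fin (r + 1) → ℝ} {C : ℝ}
    (h : IsRiesz V μ s C) {m : ℕ} (hs : ∀ l : Fin (r + 1), m ≤ l.1 → s l = 0) :
    IsRiesz V (μ.map (trunc m)) s C := by
  refine ⟨?_, h.pos, fun T hT => ?_⟩
  · rw [Measure.map_apply (by fun_prop) (measurableSet_Zspace V).compl]
    exact measure_mono_null (fun x hx (hxZ : x ∈ Zspace V) => hx (diagT_Z_diagT hxZ _))
      h.compl_eq_zero
  · have hT' := (mem_Hgrp_iff.1 hT)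
    have hl : ∀ t : ℝ, 0 < t → ∫⁻ x, ENNReal.ofReal (Real.exp (-(tip (trunc m (T * Tᵀ)) x +
        t * tip (diagT (1 - below m)) x))) ∂μ = ENNReal.ofReal (C * chi (-s) T) := by
      intro t ht
      set U : Mat r n := trunc m T + √t • diagT (1 - below m) with hU
      have hd : ∀ k, tdiag U k = if k.1 < m then tdiag T k else √t := by
        intro k
        have e1 : tdiag U k =
            tdiag (trunc m T) k + √t * tdiag (diagT (1 - below m) : Mat r n) k := by
          simp [hU, tdiag]
        rw [e1, tdiag_diagT, trunc, tdiag_diagT_mul_mul]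
        by_cases hk : k.1 < m <;> simp [below, hk]
      have hUH : U ∈ Hgrp V := by
        refine mem_Hgrp_iff.2 ⟨(lowT V).add_mem (diagT_lowT_diagT hT'.1 _ _)
          ((lowT V).smul_mem _ (diagT_mem_lowT _)), fun k => ?_⟩
        rw [hd]
        split_ifs
        · exact hT'.2 k
        · exact Real.sqrt_pos.2 ht
      have hchi : chi (-s) U = chi (-s) T := by
        refine Finset.prod_congr rfl fun k _ => ?_
        by_cases hk : k.1 < m
        · rw [hd, if_pos hk]
        · simp [hs k (not_lt.1 hk)]
      have hUU : U * Uᵀ = trunc m (T * Tᵀ) + t • diagT (1 - below m) := by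
        have z1 : trunc m T * diagT (1 - below m) = 0 := by
          rw [trunc, Matrix.mul_assoc, diagT_mul, below_mul_compl]
          simp [diagT]
        have z2 : diagT (1 - below m) * (trunc m T)ᵀ = 0 := by
          rw [← Matrix.transpose_transpose (diagT (1 - below m) * (trunc m T)ᵀ),
            Matrix.transpose_mul, Matrix.transpose_transpose, diagT_transpose, z1,
            Matrix.transpose_zero]
        have z3 : ((1 - below m) * (1 - below m) : Fin (r + 1) → ℝ) = 1 - below m := by
          ext k; by_cases hk : k.1 < m <;> simp [below, hk]
        rw [hU, trunc_mul_transpose hT'.1, Matrix.transpose_add, Matrix.transpose_smul,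
          diagT_transpose, Matrix.add_mul, Matrix.mul_add, Matrix.mul_add, Matrix.mul_smul, z1,
          Matrix.smul_mul, z2, Matrix.smul_mul, Matrix.mul_smul, diagT_mul, z3, smul_smul,
          Real.mul_self_sqrt ht.le]
        simp
      rw [← hchi, ← h.laplace_eq U hUH, hUU, laplace]
      simp only [tip_add_left, tip_smul_left]
    have h0 := ae_eq_zero_of_lintegral_exp (by fun_prop) (by fun_prop) ENNReal.ofReal_ne_top hl
    rw [laplace_map (by fun_prop), ← hl 1 one_pos]
    refine lintegral_congr_ae ?_
    filter_upwards [h0] with x hx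
    rw [hx, tip_trunc]
    simp

/-- The `i`-th block column. -/
def col {m : Type*} (B : Matrix m (Idx r n) ℝ) (i : Fin (r + 1)) : Matrix m (Fin (n i)) ℝ :=
  Matrix.of fun a c => B a ⟨i, c⟩

theorem col_mul {m : Type*} (B : Matrix m (Idx r n) ℝ) (T : Mat r n) (i : Fin (r + 1)) :
    col (B * T) i = ∑ j, col B j * blk T j i := by
  ext a c
  simp [col, Matrix.mul_apply, Matrix.sum_apply, Fintype.sum_sigma]

theorem col_ext {m : Type*} {B C : Matrix m (Idx r n) ℝ} (h : ∀ i, col B i = col C i) : B = C := by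
  ext a ⟨i, c⟩
  exact congrFun (congrFun (h i) a) c

variable (V) in
/-- Block rows with blocks in `𝒱_{ki}` for `i < k` and zero otherwise. -/
def rowSp (k : Fin (r + 1)) : Submodule ℝ (Matrix (Fin (n k)) (Idx r n) ℝ) where
  carrier := {B | ∀ i, (i < k → col B i ∈ V k i) ∧ (¬ i < k → col B i = 0)}
  add_mem' := fun {x y} hx hy i => ⟨fun h => add_mem ((hx i).1 h) ((hy i).1 h), fun h => by
    have : col (x + y) i = col x i + col y i := rfl
    rw [this, (hx i).2 h, (hy i).2 h, add_zero]⟩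
  zero_mem' := fun _ => ⟨fun _ => zero_mem _, fun _ => rfl⟩
  smul_mem' := fun c x hx i => ⟨fun h => Submodule.smul_mem _ c ((hx i).1 h), fun h => by
    have : col (c • x) i = c • col x i := rfl
    rw [this, (hx i).2 h, smul_zero]⟩

theorem rowSp_mul (hV1 : CondV1 V) {k : Fin (r + 1)} {B : Matrix (Fin (n k)) (Idx r n) ℝ}
    (hB : B ∈ rowSp V k) {T : Mat r n} (hT : T ∈ lowT V) : B * T ∈ rowSp V k := by
  intro i
  rw [col_mul]
  constructor
  · intro hi
    refine Submodule.sum_mem _ fun j _ => ?_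
    by_cases hj : j < k
    · rcases lt_trichotomy j i with h | rfl | h
      · rw [hT.1 i j h, Matrix.mul_zero]; exact zero_mem _
      · rw [lowT_diag hT, Matrix.mul_smul, Matrix.mul_one]
        exact Submodule.smul_mem _ _ ((hB j).1 hj)
      · exact hV1 i j k h hj _ ((hB j).1 hj) _ (hT.2.1 _ _ h)
    · rw [(hB j).2 hj, Matrix.zero_mul]; exact zero_mem _
  · intro hi
    refine Finset.sum_eq_zero fun j _ => ?_
    by_cases hj : j < k
    · rw [hT.1 i j (hj.trans_le (not_lt.1 hi)), Matrix.mul_zero]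
    · rw [(hB j).2 hj, Matrix.zero_mul]

variable (V) in
/-- Coordinates on `rowSp V k`. -/
abbrev RowIdx (k : Fin (r + 1)) := Σ i : {i : Fin (r + 1) // i < k}, Fin (Module.finrank ℝ (V k i))

variable (V) in
/-- The linear parametrization of `rowSp V k`. -/
noncomputable def rowOf (k : Fin (r + 1)) :
    (RowIdx V k → ℝ) →ₗ[ℝ] Matrix (Fin (n k)) (Idx r n) ℝ where
  toFun b := Matrix.of fun a q => if h : q.1 < k then
    ((Module.finBasis ℝ (V k q.1)).equivFun.symm (fun j => b ⟨⟨q.1, h⟩, j⟩) :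
      Matrix (Fin (n k)) (Fin (n q.1)) ℝ) a q.2 else 0
  map_add' b c := by
    ext a q
    simp only [Matrix.of_apply, Matrix.add_apply]
    split_ifs with h
    · have : (fun j => (b + c) ⟨⟨q.1, h⟩, j⟩) = (fun j => b ⟨⟨q.1, h⟩, j⟩) +
        fun j => c ⟨⟨q.1, h⟩, j⟩ := rfl
      rw [this, map_add]
      rfl
    · simp
  map_smul' t b := by
    ext a q
    simp only [Matrix.of_apply, Matrix.smul_apply]
    split_ifs with h
    · have : (fun j => (t • b) ⟨⟨q.1, h⟩, j⟩) = t • (fun j => b ⟨⟨q.1, h⟩, j⟩) := rfl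
      rw [this, map_smul]
      rfl
    · simp

theorem col_rowOf_of_lt {k i : Fin (r + 1)} (h : i < k) (b : RowIdx V k → ℝ) :
    col (rowOf V k b) i =
      ((Module.finBasis ℝ (V k i)).equivFun.symm (fun j => b ⟨⟨i, h⟩, j⟩) :
        Matrix (Fin (n k)) (Fin (n i)) ℝ) := by
  ext a c
  simp [col, rowOf, h]

theorem col_rowOf_of_not_lt {k i : Fin (r + 1)} (h : ¬ i < k) (b : RowIdx V k → ℝ) :
    col (rowOf V k b) i = 0 := by
  ext a c
  simp [col, rowOf, h]

theorem rowOf_mem (k : Fin (r + 1)) (b : RowIdx V k → ℝ) : rowOf V k b ∈ rowSp V k := by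
  intro i
  constructor
  · intro h; rw [col_rowOf_of_lt h]; exact Subtype.coe_prop _
  · intro h; rw [col_rowOf_of_not_lt h]

theorem rowOf_coord {k i : Fin (r + 1)} (h : i < k) {b c : RowIdx V k → ℝ}
    (hbc : col (rowOf V k b) i = col (rowOf V k c) i) (j : Fin (Module.finrank ℝ (V k i))) :
    b ⟨⟨i, h⟩, j⟩ = c ⟨⟨i, h⟩, j⟩ := by
  rw [col_rowOf_of_lt h, col_rowOf_of_lt h] at hbc
  exact congrFun ((Module.finBasis ℝ (V k i)).equivFun.symm.injective (Subtype.ext hbc)) j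

theorem rowOf_injective (k : Fin (r + 1)) : Function.Injective (rowOf V k) := by
  intro b c h
  ext ⟨⟨i, hi⟩, j⟩
  exact rowOf_coord hi (by rw [h]) j

theorem exists_rowOf {k : Fin (r + 1)} {B : Matrix (Fin (n k)) (Idx r n) ℝ}
    (hB : B ∈ rowSp V k) : ∃ b, rowOf V k b = B := by
  refine ⟨fun p => (Module.finBasis ℝ (V k p.1)).equivFun ⟨col B p.1, (hB p.1).1 p.1.2⟩ p.2,
    col_ext fun i => ?_⟩
  by_cases h : i < k
  · rw [col_rowOf_of_lt h]
    have := (Module.finBasis ℝ (V k i)).equivFun.symm_apply_apply ⟨col B i, (hB i).1 h⟩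
    exact congrArg Subtype.val this
  · rw [col_rowOf_of_not_lt h, (hB i).2 h]

theorem exists_rowOf_mul (hV1 : CondV1 V) (k : Fin (r + 1)) {T : Mat r n} (hT : T ∈ lowT V) :
    ∃ φ : (RowIdx V k → ℝ) →ₗ[ℝ] (RowIdx V k → ℝ), ∀ b, rowOf V k (φ b) = rowOf V k b * T := by
  have h : ∀ b, ∃ c, rowOf V k c = rowOf V k b * T := fun b =>
    exists_rowOf (rowSp_mul hV1 (rowOf_mem k b) hT)
  choose f hf using h
  refine ⟨⟨⟨f, fun b c => rowOf_injective k ?_⟩, fun t b => rowOf_injective k ?_⟩, hf⟩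
  · simp [hf, Matrix.add_mul]
  · simp [hf]

theorem det_rowOf_mul {k : Fin (r + 1)} {T : Mat r n} (hT : T ∈ lowT V)
    {φ : (RowIdx V k → ℝ) →ₗ[ℝ] (RowIdx V k → ℝ)} (hφ : ∀ b, rowOf V k (φ b) = rowOf V k b * T) :
    LinearMap.det φ =
      ∏ i : {i : Fin (r + 1) // i < k}, tdiag T i ^ Module.finrank ℝ (V k i) := by
  have hz : ∀ (q : RowIdx V k) (i : Fin (r + 1)), i ≠ q.1 →
      col (rowOf V k (Pi.single q 1)) i = 0 := by
    intro q i hi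
    by_cases h : i < k
    · rw [col_rowOf_of_lt h]
      have : (fun j => (Pi.single q 1 : RowIdx V k → ℝ) ⟨⟨i, h⟩, j⟩) = 0 := by
        ext j
        refine Pi.single_eq_of_ne (fun e => hi ?_) _
        rw [← e]
      rw [this, map_zero]; rfl
    · exact col_rowOf_of_not_lt h _
  have hc : ∀ (q : RowIdx V k) (i : Fin (r + 1)), col (rowOf V k (φ (Pi.single q 1))) i =
      col (rowOf V k (Pi.single q 1)) q.1 * blk T q.1 i := by
    intro q i
    rw [hφ, col_mul]
    refine Finset.sum_eq_single _ (fun j _ hj => ?_) (by simp)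
    rw [hz q j hj, Matrix.zero_mul]
  classical
  have key := det_of_blockTriangular (LinearMap.toMatrix' φ) (fun i => tdiag T i) ?_ ?_
  · rw [← LinearMap.det_toMatrix']
    simp only [Fintype.card_fin] at key
    convert key
  · rintro ⟨⟨i, hi⟩, j⟩ q hq
    rw [LinearMap.toMatrix'_apply]
    refine rowOf_coord (c := 0) hi ?_ j
    rw [hc, hT.1 i q.1 hq, Matrix.mul_zero, map_zero]
    rfl
  · rintro ⟨i, hi⟩ a b
    rw [LinearMap.toMatrix'_apply]
    have : φ (Pi.single ⟨⟨i, hi⟩, b⟩ 1) ⟨⟨i, hi⟩, a⟩ =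
        (tdiag T i • Pi.single ⟨⟨i, hi⟩, b⟩ 1 : RowIdx V k → ℝ) ⟨⟨i, hi⟩, a⟩ := by
      refine rowOf_coord hi ?_ a
      rw [hc, lowT_diag hT, Matrix.mul_smul, Matrix.mul_one, map_smul]
      rfl
    rw [this]
    simp [Pi.single_apply]

theorem continuous_fsq {m : Type*} [Fintype m] :
    Continuous (fsq : Matrix m (Idx r n) ℝ → ℝ) :=
  (continuous_id.matrix_mul continuous_id.matrix_transpose).matrix_trace

@[fun_prop]
theorem measurable_fsq {m : Type*} [Fintype m] :
    Measurable (fsq : Matrix m (Idx r n) ℝ → ℝ) := continuous_fsq.measurable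

variable (V) in
theorem continuous_rowOf (k : Fin (r + 1)) : Continuous (rowOf V k) :=
  LinearMap.continuous_of_finiteDimensional _

variable (V) in
@[fun_prop]
theorem measurable_rowOf (k : Fin (r + 1)) : Measurable (rowOf V k) :=
  (continuous_rowOf V k).measurable

variable (V) in
/-- The Gaussian integral over `rowSp V k`. -/
noncomputable def gaussK (k : Fin (r + 1)) : ℝ≥0∞ :=
  ∫⁻ b : RowIdx V k → ℝ, ENNReal.ofReal (Real.exp (-fsq (rowOf V k b)))

theorem gaussK_ne_zero (k : Fin (r + 1)) : gaussK V k ≠ 0 := by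
  rw [gaussK, Ne, lintegral_eq_zero_iff (by fun_prop)]
  intro h
  have h2 : ∀ᵐ x : RowIdx V k → ℝ, False := by
    filter_upwards [h] with x hx
    simp at hx
    exact absurd hx (not_le.2 (Real.exp_pos _))
  rw [Filter.eventually_false_iff_eq_bot, ae_eq_bot] at h2
  exact NeZero.ne (volume : Measure (RowIdx V k → ℝ)) h2

variable (V) in
theorem exists_le_fsq_rowOf (k : Fin (r + 1)) :
    ∃ c > 0, ∀ b, c * ∑ i, b i ^ 2 ≤ fsq (rowOf V k b) := by
  let f : (RowIdx V k → ℝ) →ₗ[ℝ] (Fin (n k) → Idx r n → ℝ) := rowOf V k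
  obtain ⟨K, hK0, hK⟩ := LinearMap.exists_antilipschitzWith f
    (LinearMap.ker_eq_bot.2 (rowOf_injective k))
  have hb : ∀ b, ‖b‖ ≤ K * √(fsq (rowOf V k b)) := by
    intro b
    have h1 := hK.le_mul_norm (f := f) (map_zero f) b
    refine h1.trans (mul_le_mul_of_nonneg_left ?_ K.2)
    refine (pi_norm_le_iff_of_nonneg (Real.sqrt_nonneg _)).2 fun a =>
      (pi_norm_le_iff_of_nonneg (Real.sqrt_nonneg _)).2 fun q => Real.abs_le_sqrt ?_
    rw [fsq_eq]
    refine (Finset.single_le_sum (f := fun q => rowOf V k b a q ^ 2) (fun _ _ => sq_nonneg _)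
      (Finset.mem_univ q)).trans ?_
    exact Finset.single_le_sum (f := fun a => ∑ q, rowOf V k b a q ^ 2)
      (fun _ _ => by positivity) (Finset.mem_univ a)
  set d : ℝ := (Fintype.card (RowIdx V k) : ℝ) + 1 with hd
  have hd0 : 0 < d := by positivity
  have hK0' : (0 : ℝ) < K := hK0
  refine ⟨(d * K ^ 2)⁻¹, by positivity, fun b => ?_⟩
  rw [inv_mul_le_iff₀ (by positivity)]
  have h2 : ∀ i, b i ^ 2 ≤ K ^ 2 * fsq (rowOf V k b) := by
    intro i
    have h3 : |b i| ≤ K * √(fsq (rowOf V k b)) := (norm_le_pi_norm b i).trans (hb b)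
    have h4 := pow_le_pow_left₀ (abs_nonneg _) h3 2
    rwa [sq_abs, mul_pow, Real.sq_sqrt (fsq_nonneg _)] at h4
  calc ∑ i, b i ^ 2 ≤ ∑ _i : RowIdx V k, K ^ 2 * fsq (rowOf V k b) :=
        Finset.sum_le_sum fun i _ => h2 i
    _ = Fintype.card (RowIdx V k) * (K ^ 2 * fsq (rowOf V k b)) := by simp
    _ ≤ d * K ^ 2 * fsq (rowOf V k b) := by
      rw [mul_assoc]
      exact mul_le_mul_of_nonneg_right (by rw [hd]; linarith)
        (mul_nonneg (sq_nonneg _) (fsq_nonneg _))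

theorem gaussK_ne_top (k : Fin (r + 1)) : gaussK V k ≠ ∞ := by
  obtain ⟨c, hc, h⟩ := exists_le_fsq_rowOf V k
  have hi : Integrable (fun b : RowIdx V k → ℝ => ∏ i, Real.exp (-c * b i ^ 2)) :=
    Integrable.fintype_prod fun _ => integrable_exp_neg_mul_sq hc
  refine ne_top_of_le_ne_top hi.lintegral_lt_top.ne (lintegral_mono fun b => ?_)
  refine ENNReal.ofReal_le_ofReal ?_
  rw [← Real.exp_sum, Real.exp_le_exp, ← Finset.mul_sum]
  linarith [h b]

variable (V) in
/-- Half the dimensions of the spaces `𝒱_{ki}`, `i < k`. -/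
noncomputable def halfDim (k i : Fin (r + 1)) : ℝ :=
  if i < k then (Module.finrank ℝ (V k i) : ℝ) / 2 else 0

theorem det_eq_chi {k : Fin (r + 1)} {T : Mat r n} (hT : T ∈ Hgrp V)
    {φ : (RowIdx V k → ℝ) →ₗ[ℝ] (RowIdx V k → ℝ)} (hφ : ∀ b, rowOf V k (φ b) = rowOf V k b * T) :
    LinearMap.det φ = chi (halfDim V k) T := by
  rw [det_rowOf_mul (mem_Hgrp_iff.1 hT).1 hφ, chi]
  have h1 : ∀ i, tdiag T i ^ (2 * halfDim V k i) =
      if i < k then tdiag T i ^ Module.finrank ℝ (V k i) else 1 := by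
    intro i
    unfold halfDim
    split_ifs
    · rw [mul_div_cancel₀ _ two_ne_zero, Real.rpow_natCast]
    · simp
  simp only [h1]
  rw [← Finset.prod_filter, ← Finset.prod_subtype_eq_prod_filter]
  refine Finset.prod_congr ?_ fun _ _ => rfl
  ext i
  simp

theorem chi_neg (s : Fin (r + 1) → ℝ) {T : Mat r n} (hT : T ∈ Hgrp V) :
    chi (-s) T = (chi s T)⁻¹ := by
  simp only [chi, ← Finset.prod_inv_distrib]
  refine Finset.prod_congr rfl fun k _ => ?_
  rw [← Real.rpow_neg ((mem_Hgrp_iff.1 hT).2 k).le, Pi.neg_apply, mul_neg]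

theorem lintegral_rowOf_mul_add (hV1 : CondV1 V) {k : Fin (r + 1)} {T : Mat r n} (hT : T ∈ Hgrp V)
    {B₀ : Matrix (Fin (n k)) (Idx r n) ℝ} (hB₀ : B₀ ∈ rowSp V k) :
    ∫⁻ b : RowIdx V k → ℝ, ENNReal.ofReal (Real.exp (-fsq (rowOf V k b * T + B₀))) =
      ENNReal.ofReal (chi (-halfDim V k) T) * gaussK V k := by
  obtain ⟨φ, hφ⟩ := exists_rowOf_mul hV1 k (mem_Hgrp_iff.1 hT).1
  obtain ⟨c, rfl⟩ := exists_rowOf hB₀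
  have hdet := det_eq_chi hT hφ
  have hpos := chi_pos (halfDim V k) hT
  have hmap := Real.map_linearMap_volume_pi_eq_smul_volume_pi (f := φ)
    (by rw [hdet]; exact hpos.ne')
  have hφm : Measurable φ := (LinearMap.continuous_of_finiteDimensional φ).measurable
  calc _ = ∫⁻ b : RowIdx V k → ℝ, ENNReal.ofReal (Real.exp (-fsq (rowOf V k (φ b + c)))) := by
        simp only [map_add, hφ]
    _ = ∫⁻ b, ENNReal.ofReal (Real.exp (-fsq (rowOf V k (b + c)))) ∂(Measure.map φ volume) :=
        (lintegral_map (f := fun b => ENNReal.ofReal (Real.exp (-fsq (rowOf V k (b + c)))))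
          (by fun_prop) hφm).symm
    _ = _ := by
      rw [hmap, lintegral_smul_measure,
        lintegral_add_right_eq_self (fun b => ENNReal.ofReal (Real.exp (-fsq (rowOf V k b)))),
        hdet, chi_neg _ hT, abs_of_pos (inv_pos.2 hpos), gaussK, smul_eq_mul]

/-- The block row selecting the rows of block `k`. -/
def selRow (n : Fin (r + 1) → ℕ+) (k : Fin (r + 1)) : Matrix (Fin (n k)) (Idx r n) ℝ :=
  Matrix.of fun a q => if q = ⟨k, a⟩ then 1 else 0

theorem selRow_mul_apply (k : Fin (r + 1)) (x : Mat r n) (a : Fin (n k)) (q : Idx r n) :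
    (selRow n k * x) a q = x ⟨k, a⟩ q := by
  simp [selRow, Matrix.mul_apply]

theorem col_selRow_mul (k i : Fin (r + 1)) (x : Mat r n) : col (selRow n k * x) i = blk x k i := by
  ext a c
  exact selRow_mul_apply k x a ⟨i, c⟩

theorem col_selRow_of_ne {k i : Fin (r + 1)} (h : i ≠ k) :
    col (selRow n k) i = 0 := by
  ext a c
  simp [col, selRow, h]

theorem col_selRow_self (k : Fin (r + 1)) :
    col (selRow n k) k = 1 := by
  ext a c
  simp [col, selRow, Matrix.one_apply, eq_comm]

/-- The strictly lower part of the block row `k`. -/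
def lowRow (k : Fin (r + 1)) (x : Mat r n) : Matrix (Fin (n k)) (Idx r n) ℝ :=
  Matrix.of fun a q => if q.1 < k then x ⟨k, a⟩ q else 0

theorem col_lowRow_of_lt {k i : Fin (r + 1)} (h : i < k) (x : Mat r n) :
    col (lowRow k x) i = blk x k i := by
  ext a c
  simp [col, lowRow, h]

theorem col_lowRow_of_not_lt {k i : Fin (r + 1)} (h : ¬ i < k) (x : Mat r n) :
    col (lowRow k x) i = 0 := by
  ext a c
  simp [col, lowRow, h]

theorem lowRow_mem_of_lowT {T : Mat r n} (hT : T ∈ lowT V) (k : Fin (r + 1)) :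
    lowRow k T ∈ rowSp V k := fun i =>
  ⟨fun h => by rw [col_lowRow_of_lt h]; exact hT.2.1 _ _ h, fun h => col_lowRow_of_not_lt h _⟩

theorem selRow_mul_lowT {T : Mat r n} (hT : T ∈ lowT V) (k : Fin (r + 1)) :
    selRow n k * T = lowRow k T + tdiag T k • selRow n k := by
  refine col_ext fun i => ?_
  have h : col (lowRow k T + tdiag T k • selRow n k) i =
    col (lowRow k T) i + tdiag T k • col (selRow n k) i := rfl
  rw [h, col_selRow_mul]
  rcases lt_trichotomy i k with h | rfl | h
  · rw [col_lowRow_of_lt h, col_selRow_of_ne h.ne, smul_zero, add_zero]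
  · rw [col_lowRow_of_not_lt (lt_irrefl _), col_selRow_self, zero_add, lowT_diag hT]
  · rw [col_lowRow_of_not_lt h.not_gt, col_selRow_of_ne h.ne', smul_zero, add_zero, hT.1 i k h]

theorem rowSp_apply_eq_zero {k : Fin (r + 1)} {B : Matrix (Fin (n k)) (Idx r n) ℝ}
    (hB : B ∈ rowSp V k) (a : Fin (n k)) {q : Idx r n} (hq : ¬ q.1 < k) : B a q = 0 :=
  congrFun (congrFun ((hB q.1).2 hq) a) q.2

theorem fsq_add_smul_selRow {k : Fin (r + 1)} {B : Matrix (Fin (n k)) (Idx r n) ℝ}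
    (hB : B ∈ rowSp V k) (c : ℝ) : fsq (B + c • selRow n k) = fsq B + n k * c ^ 2 := by
  have h : ∀ a q, (B + c • selRow n k) a q ^ 2 = B a q ^ 2 + if q = ⟨k, a⟩ then c ^ 2 else 0 := by
    intro a q
    by_cases hq : q = ⟨k, a⟩
    · subst hq
      simp [selRow, rowSp_apply_eq_zero hB a (q := ⟨k, a⟩) (lt_irrefl k)]
    · simp [selRow, hq]
  simp only [fsq_eq, h, Finset.sum_add_distrib]
  simp

theorem chi_add_single (s : Fin (r + 1) → ℝ) (k : Fin (r + 1)) (u : ℝ) {T : Mat r n}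
    (hT : T ∈ Hgrp V) : chi (-(s + Pi.single k u)) T = chi (-s) T * tdiag T k ^ (-(2 * u)) := by
  rw [neg_add, chi_add _ _ hT]
  congr 1
  rw [chi, Finset.prod_eq_single k]
  · simp
  · intro i _ hi; simp [hi]
  · simp

theorem exists_isRiesz_gen (hV1 : CondV1 V) (hV2 : CondV2 V) (hV3 : CondV3 V) (k : Fin (r + 1))
    {u : ℝ} (hu : 0 < u) : ∃ μ C, IsRiesz V μ (halfDim V k + Pi.single k u) C := by
  let ν : Measure ℝ := (volume.restrict (Set.Ioi 0)).withDensity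
    fun c => ENNReal.ofReal (c ^ (2 * u - 1))
  let M : (RowIdx V k → ℝ) × ℝ → Matrix (Fin (n k)) (Idx r n) ℝ :=
    fun p => rowOf V k p.1 + p.2 • selRow n k
  have hMc : Continuous M := by
    have := continuous_rowOf V k
    fun_prop
  have hf : Measurable fun p => projZ V ((M p)ᵀ * M p) :=
    (measurable_projZ V).comp (hMc.matrix_transpose.matrix_mul hMc).measurable
  have hn : (0 : ℝ) < n k := by exact_mod_cast (n k).pos
  have hν : ∀ b : ℝ, 0 < b → ∫⁻ c, ENNReal.ofReal (Real.exp (-(b * c ^ 2))) ∂ν =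
      ENNReal.ofReal (b ^ (-u) * (1 / 2) * Real.Gamma u) := by
    intro b hb
    rw [lintegral_withDensity_eq_lintegral_mul _ (by fun_prop) (by fun_prop)]
    have h1 := integral_rpow_mul_exp_neg_mul_rpow (p := 2) (q := 2 * u - 1) two_pos
      (by linarith) hb
    have h2 := integrableOn_rpow_mul_exp_neg_mul_rpow (p := 2) (s := 2 * u - 1) (by linarith)
      (by norm_num) hb
    have e1 : -(2 * u - 1 + 1) / 2 = -u := by ring
    have e2 : (2 * u - 1 + 1) / 2 = u := by ring
    rw [e1, e2] at h1
    rw [← h1, ofReal_integral_eq_lintegral_ofReal h2]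
    · refine setLIntegral_congr_fun measurableSet_Ioi fun c hc => ?_
      have hc : 0 < c := hc
      rw [Pi.mul_apply, ← ENNReal.ofReal_mul (by positivity), Real.rpow_two, neg_mul]
    · filter_upwards [ae_restrict_mem measurableSet_Ioi] with c hc
      have hc : 0 < c := hc
      simp only [Pi.zero_apply]
      positivity
  refine ⟨(volume.prod ν).map fun p => projZ V ((M p)ᵀ * M p),
    (gaussK V k).toReal * ((n k : ℝ) ^ (-u) * (1 / 2) * Real.Gamma u), ?_, ?_, fun T hT => ?_⟩
  · rw [Measure.map_apply hf (measurableSet_Zspace V).compl]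
    convert measure_empty (μ := volume.prod ν)
    ext p
    simp [projZ_mem]
  · have := Real.Gamma_pos_of_pos hu
    have h1 := ENNReal.toReal_pos (gaussK_ne_zero (V := V) k) (gaussK_ne_top k)
    positivity
  · have hT' := mem_Hgrp_iff.1 hT
    have ht := hT'.2 k
    have e : ∀ p, tip (T * Tᵀ) (projZ V ((M p)ᵀ * M p)) =
        fsq (rowOf V k p.1 * T + p.2 • lowRow k T) + n k * tdiag T k ^ 2 * p.2 ^ 2 := by
      intro p
      rw [tip_projZ (mul_transpose_mem_Z hV2 hV3 hT'.1), tip_gram, Matrix.add_mul,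
        Matrix.smul_mul, selRow_mul_lowT hT'.1, smul_add, smul_smul, ← add_assoc,
        fsq_add_smul_selRow]
      · ring
      · exact add_mem (rowSp_mul hV1 (rowOf_mem k _) hT'.1)
          (Submodule.smul_mem _ _ (lowRow_mem_of_lowT hT'.1 k))
    have e3 : ((n k : ℝ) * tdiag T k ^ 2) ^ (-u) = (n k : ℝ) ^ (-u) * tdiag T k ^ (-(2 * u)) := by
      rw [Real.mul_rpow hn.le (sq_nonneg _), ← Real.rpow_natCast, ← Real.rpow_mul ht.le]
      congr 2
      push_cast; ring
    rw [laplace_map hf, chi_add_single _ _ _ hT]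
    simp only [e]
    have hm : Continuous fun p : (RowIdx V k → ℝ) × ℝ =>
        rowOf V k p.1 * T + p.2 • lowRow k T :=
      (((continuous_rowOf V k).comp continuous_fst).matrix_mul continuous_const).add
        (continuous_snd.smul continuous_const)
    have hm' := measurable_fsq.comp hm.measurable
    rw [lintegral_prod_symm' (fun p : (RowIdx V k → ℝ) × ℝ => ENNReal.ofReal (Real.exp
      (-(fsq (rowOf V k p.1 * T + p.2 • lowRow k T) + n k * tdiag T k ^ 2 * p.2 ^ 2))))
      (ENNReal.measurable_ofReal.comp (Real.measurable_exp.comp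
        (hm'.add (by fun_prop)).neg))]
    simp only [neg_add, Real.exp_add, ENNReal.ofReal_mul (Real.exp_pos _).le]
    have h3 : ∀ c : ℝ, ∫⁻ b : RowIdx V k → ℝ,
        ENNReal.ofReal (Real.exp (-fsq (rowOf V k b * T + c • lowRow k T))) *
        ENNReal.ofReal (Real.exp (-(n k * tdiag T k ^ 2 * c ^ 2))) =
        ENNReal.ofReal (chi (-halfDim V k) T) * gaussK V k *
        ENNReal.ofReal (Real.exp (-(n k * tdiag T k ^ 2 * c ^ 2))) := by
      intro c
      rw [lintegral_mul_const' _ _ ENNReal.ofReal_ne_top, lintegral_rowOf_mul_add hV1 hT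
        (Submodule.smul_mem _ _ (lowRow_mem_of_lowT hT'.1 k))]
    simp only [h3]
    rw [lintegral_const_mul _ (by fun_prop), hν _ (by positivity), e3]
    have h4 : gaussK V k = ENNReal.ofReal (gaussK V k).toReal :=
      (ENNReal.ofReal_toReal (gaussK_ne_top k)).symm
    have h5 := (chi_pos (-halfDim V k) hT).le
    conv_lhs => rw [h4]
    rw [← ENNReal.ofReal_mul h5, ← ENNReal.ofReal_mul (by positivity)]
    congr 1
    ring

theorem isRiesz_zero : IsRiesz V (Measure.dirac 0) 0 1 := by
  refine ⟨?_, one_pos, fun T _ => ?_⟩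
  · rw [Measure.dirac_apply' _ (measurableSet_Zspace V).compl]
    have : (0 : Mat r n) ∈ Zspace V := (Zsub V).zero_mem
    simp [this]
  · rw [laplace, lintegral_dirac' _ (by fun_prop)]
    simp [tip, chi]

theorem IsRiesz.add {μ₁ μ₂ : Measure (Mat r n)} {s₁ s₂ : Fin (r + 1) → ℝ} {C₁ C₂ : ℝ}
    (h₁ : IsRiesz V μ₁ s₁ C₁) (h₂ : IsRiesz V μ₂ s₂ C₂) :
    IsRiesz V ((μ₁.prod μ₂).map fun p => p.1 + p.2) (s₁ + s₂) (C₁ * C₂) := by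
  have := h₁.sFinite
  have := h₂.sFinite
  have hm : Measurable fun p : Mat r n × Mat r n => p.1 + p.2 :=
    (continuous_fst.add continuous_snd).measurable
  refine ⟨?_, mul_pos h₁.pos h₂.pos, fun T hT => ?_⟩
  · rw [Measure.map_apply hm (measurableSet_Zspace V).compl]
    refine measure_mono_null (t := (Zspace V)ᶜ ×ˢ Set.univ ∪ Set.univ ×ˢ (Zspace V)ᶜ) ?_ ?_
    · rintro ⟨x, y⟩ hxy
      by_contra hn
      simp only [Set.mem_union, Set.mem_prod, Set.mem_compl_iff, Set.mem_univ, and_true,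
        true_and, not_or, not_not] at hn
      exact hxy ((Zsub V).add_mem hn.1 hn.2)
    · refine measure_union_null ?_ ?_
      · rw [Measure.prod_prod, h₁.compl_eq_zero, zero_mul]
      · rw [Measure.prod_prod, h₂.compl_eq_zero, mul_zero]
  · rw [laplace_map hm]
    simp only [tip_add_right, neg_add, Real.exp_add, ENNReal.ofReal_mul (Real.exp_pos _).le]
    rw [lintegral_prod_mul (f := fun x => ENNReal.ofReal (Real.exp (-(tip (T * Tᵀ) x))))
      (g := fun x => ENNReal.ofReal (Real.exp (-(tip (T * Tᵀ) x)))) (by fun_prop) (by fun_prop)]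
    change laplace μ₁ _ * laplace μ₂ _ = _
    have p1 := chi_pos (-s₁) hT
    have p2 := h₁.pos
    rw [h₁.laplace_eq T hT, h₂.laplace_eq T hT, ← ENNReal.ofReal_mul (by positivity),
      chi_add _ _ hT]
    congr 1; ring

theorem IsRiesz.smul {μ : Measure (Mat r n)} {s : Fin (r + 1) → ℝ} {C : ℝ}
    (h : IsRiesz V μ s C) {a : ℝ} (ha : 0 < a) :
    IsRiesz V (ENNReal.ofReal a • μ) s (a * C) := by
  refine ⟨by simp [h.compl_eq_zero], mul_pos ha h.pos, fun T hT => ?_⟩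
  rw [laplace, lintegral_smul_measure]
  change _ • laplace μ _ = _
  rw [h.laplace_eq T hT, smul_eq_mul, ← ENNReal.ofReal_mul ha.le, mul_assoc]

theorem exists_isRiesz_sum (hV1 : CondV1 V) (hV2 : CondV2 V) (hV3 : CondV3 V)
    (u : Fin (r + 1) → ℝ) (S : Finset (Fin (r + 1))) (hu : ∀ k ∈ S, 0 < u k) :
    ∃ μ C, IsRiesz V μ (∑ k ∈ S, (halfDim V k + Pi.single k (u k))) C := by
  induction S using Finset.induction_on with
  | empty => exact ⟨_, _, isRiesz_zero⟩
  | insert k S hk ih =>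
    obtain ⟨μ, C, h⟩ := ih fun i hi => hu i (Finset.mem_insert_of_mem hi)
    obtain ⟨μ', C', h'⟩ := exists_isRiesz_gen hV1 hV2 hV3 k (hu k (Finset.mem_insert_self _ _))
    rw [Finset.sum_insert hk]
    exact ⟨_, _, h'.add h⟩

theorem frakBound_eq (ε : Fin (r + 1) → Bool) (k : Fin (r + 1)) :
    frakBound V ε k = ∑ l, if ε l then halfDim V l k else 0 := by
  rw [frakBound, Finset.sum_filter, Finset.mul_sum]
  refine Finset.sum_congr rfl fun l _ => ?_
  unfold halfDim
  split_ifs <;> ring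

theorem exists_isRiesz_of_mem (hV1 : CondV1 V) (hV2 : CondV2 V) (hV3 : CondV3 V)
    {s : Fin (r + 1) → ℝ} (hs : s ∈ frakX V) : ∃ μ, IsRiesz V μ s 1 := by
  obtain ⟨ε, hε⟩ := Set.mem_iUnion.1 hs
  obtain ⟨μ, C, h⟩ := exists_isRiesz_sum hV1 hV2 hV3 (fun k => s k - frakBound V ε k)
    (Finset.univ.filter fun k => ε k = true)
    (fun k hk => sub_pos.2 ((hε k).1 (Finset.mem_filter.1 hk).2))
  have e : ∑ k ∈ Finset.univ.filter (fun k => ε k = true),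
      (halfDim V k + Pi.single k (s k - frakBound V ε k)) = s := by
    ext i
    rw [Finset.sum_apply, Finset.sum_filter]
    have : ∀ k, (if ε k = true then
        (halfDim V k + Pi.single k (s k - frakBound V ε k) : Fin (r + 1) → ℝ) i else 0) =
        (if ε k = true then halfDim V k i else 0) +
        if i = k then (if ε k = true then s k - frakBound V ε k else 0) else 0 := by
      intro k
      by_cases hk : ε k = true <;> by_cases hi : i = k <;> simp [hk, hi]
    simp only [this, Finset.sum_add_distrib, ← frakBound_eq, Finset.sum_ite_eq,
      Finset.mem_univ, if_true]
    split_ifs with hi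
    · ring
    · rw [(hε i).2 (by simpa using hi), add_zero]
  rw [e] at h
  have := h.smul (inv_pos.2 h.pos)
  rw [inv_mul_cancel₀ h.pos.ne'] at this
  exact ⟨_, this⟩

open ProbabilityTheory in
theorem complexMGF_eqOn_of_lintegral_exp {Ω : Type*} [MeasurableSpace Ω] {μ ν : Measure Ω}
    {X : Ω → ℝ} (hX : Measurable X) {ε : ℝ} (hε : 0 < ε)
    (hμ : ∀ t, |t| < ε → ∫⁻ x, ENNReal.ofReal (Real.exp (t * X x)) ∂μ ≠ ∞)
    (h : ∀ t, |t| < ε → ∫⁻ x, ENNReal.ofReal (Real.exp (t * X x)) ∂μ =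
      ∫⁻ x, ENNReal.ofReal (Real.exp (t * X x)) ∂ν) :
    Set.EqOn (complexMGF X μ) (complexMGF X ν) {z | z.re ∈ Set.Ioo (-ε) ε} := by
  have hint : ∀ ρ : Measure Ω,
      (∀ t, |t| < ε → ∫⁻ x, ENNReal.ofReal (Real.exp (t * X x)) ∂ρ ≠ ∞) →
      AnalyticOnNhd ℂ (complexMGF X ρ) {z | z.re ∈ Set.Ioo (-ε) ε} := by
    intro ρ hρ
    refine (analyticOnNhd_complexMGF (X := X) (μ := ρ)).mono fun z hz => ?_
    refine interior_mono (s := Set.Ioo (-ε) ε) (fun t ht => ?_) (by simpa using hz)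
    exact (lintegral_ofReal_ne_top_iff_integrable (by fun_prop)
      (.of_forall fun x => (Real.exp_pos _).le)).1 (hρ t (abs_lt.2 ht))
  have hmgf : ∀ t, |t| < ε → mgf X μ t = mgf X ν t := by
    intro t ht
    rw [mgf, mgf, integral_eq_lintegral_of_nonneg_ae (.of_forall fun x => (Real.exp_pos _).le)
      (by fun_prop), integral_eq_lintegral_of_nonneg_ae (.of_forall fun x => (Real.exp_pos _).le)
      (by fun_prop), h t ht]
  refine AnalyticOnNhd.eqOn_of_preconnected_of_frequently_eq (hint μ hμ)
    (hint ν fun t ht => h t ht ▸ hμ t ht)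
    ((convex_Ioo (-ε) ε).linear_preimage Complex.reLm).isPreconnected
    (z₀ := 0) (by simp [hε]) ?_
  have h_real : ∃ᶠ x : ℝ in nhdsWithin 0 {0}ᶜ, complexMGF X μ x = complexMGF X ν x := by
    refine Filter.Eventually.frequently ?_
    filter_upwards [nhdsWithin_le_nhds (Metric.ball_mem_nhds (0 : ℝ) hε)] with t ht
    rw [complexMGF_ofReal, complexMGF_ofReal, hmgf t (by simpa using ht)]
  rw [Filter.frequently_iff_seq_forall] at h_real ⊢
  obtain ⟨xs, hx_tendsto, hx_eq⟩ := h_real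
  refine ⟨fun n => xs n, ?_, hx_eq⟩
  rw [tendsto_nhdsWithin_iff] at hx_tendsto ⊢
  refine ⟨?_, by simpa using hx_tendsto.2⟩
  exact (Complex.continuous_ofReal.tendsto' 0 0 Complex.ofReal_zero).comp hx_tendsto.1

theorem exists_pos_posDef_one_add_smul (y : Mat r n) (hy : y.IsSymm) :
    ∃ ε > 0, ∀ t : ℝ, |t| < ε → (1 + t • y).PosDef := by
  set M : ℝ := ∑ p, ∑ q, |y p q| with hM
  have hM0 : 0 ≤ M := by positivity
  refine ⟨1 / (M + 1), by positivity, fun t ht => ?_⟩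
  rw [Matrix.posDef_iff_dotProduct_mulVec]
  refine ⟨by simp [Matrix.IsHermitian, hy.eq], fun x hx => ?_⟩
  have hN : 0 < x ⬝ᵥ x := by
    rw [← star_trivial x]
    exact (Matrix.dotProduct_star_self_pos_iff).2 hx
  have hle : ∀ p q, |x p * x q| ≤ x ⬝ᵥ x := by
    intro p q
    have h1 : ∀ p, x p ^ 2 ≤ x ⬝ᵥ x := fun p => by
      simp only [dotProduct, ← sq]
      exact Finset.single_le_sum (f := fun p => x p ^ 2) (fun i _ => sq_nonneg _)
        (Finset.mem_univ p)
    rw [abs_le]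
    constructor <;> nlinarith [h1 p, h1 q, sq_nonneg (x p + x q), sq_nonneg (x p - x q)]
  have hQ : |x ⬝ᵥ y *ᵥ x| ≤ M * (x ⬝ᵥ x) := by
    have h2 : x ⬝ᵥ y *ᵥ x = ∑ p, ∑ q, y p q * (x p * x q) := by
      simp only [dotProduct, mulVec, Finset.mul_sum]
      exact Finset.sum_congr rfl fun p _ => Finset.sum_congr rfl fun q _ => by ring
    rw [h2, hM, Finset.sum_mul]
    refine (Finset.abs_sum_le_sum_abs _ _).trans (Finset.sum_le_sum fun p _ => ?_)
    rw [Finset.sum_mul]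
    refine (Finset.abs_sum_le_sum_abs _ _).trans (Finset.sum_le_sum fun q _ => ?_)
    rw [abs_mul]
    exact mul_le_mul_of_nonneg_left (hle p q) (abs_nonneg _)
  have h3 : |t * (x ⬝ᵥ y *ᵥ x)| < x ⬝ᵥ x := by
    rw [abs_mul]
    calc _ ≤ 1 / (M + 1) * (M * (x ⬝ᵥ x)) := mul_le_mul ht.le hQ (abs_nonneg _) (by positivity)
      _ = M / (M + 1) * (x ⬝ᵥ x) := by ring
      _ < 1 * (x ⬝ᵥ x) := by
        gcongr
        rw [div_lt_one (by positivity)]; linarith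
      _ = _ := one_mul _
  have h4 : star x ⬝ᵥ (1 + t • y) *ᵥ x = x ⬝ᵥ x + t * (x ⬝ᵥ y *ᵥ x) := by
    rw [star_trivial, Matrix.add_mulVec, dotProduct_add, Matrix.one_mulVec, Matrix.smul_mulVec,
      dotProduct_smul, smul_eq_mul]
  rw [h4]
  linarith [(abs_lt.1 h3).1]

/-- A measure on `𝒵` is determined by its Laplace transform on `𝒫`. -/
theorem ext_of_laplace {μ ν : Measure (Mat r n)} (hμ : μ (Zspace V)ᶜ = 0)
    (hν : ν (Zspace V)ᶜ = 0) (hfin : ∀ θ ∈ Pcone V, laplace μ θ ≠ ∞)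
    (h : ∀ θ ∈ Pcone V, laplace μ θ = laplace ν θ) : μ = ν := by
  set g : Mat r n → ℝ := fun x => -(tip 1 x) with hg_def
  have hg : Measurable g := by fun_prop
  rw [← withDensity_exp_neg (μ := μ) hg, ← withDensity_exp_neg (μ := ν) hg]
  congr 1
  have h1 : (1 : Mat r n) ∈ Pcone V := ⟨one_mem_Z, .one⟩
  have hfμ : IsFiniteMeasure (μ.withDensity fun x => ENNReal.ofReal (Real.exp (g x))) :=
    isFiniteMeasure_withDensity (hfin 1 h1)
  have hfν : IsFiniteMeasure (ν.withDensity fun x => ENNReal.ofReal (Real.exp (g x))) :=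
    isFiniteMeasure_withDensity (by
      have h2 := hfin 1 h1
      rwa [h 1 h1] at h2)
  set μ' := μ.withDensity fun x => ENNReal.ofReal (Real.exp (g x))
  set ν' := ν.withDensity fun x => ENNReal.ofReal (Real.exp (g x))
  have haeμ : ∀ᵐ x ∂μ', x ∈ Zspace V := withDensity_absolutelyContinuous _ _ (mem_ae_iff.2 hμ)
  have haeν : ∀ᵐ x ∂ν', x ∈ Zspace V := withDensity_absolutelyContinuous _ _ (mem_ae_iff.2 hν)
  have hexp : ∀ (ρ : Measure (Mat r n)) (y : Mat r n) (t : ℝ),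
      ∫⁻ x, ENNReal.ofReal (Real.exp (t * tip y x))
        ∂(ρ.withDensity fun x => ENNReal.ofReal (Real.exp (g x))) =
      laplace ρ (1 + (-t) • y) := by
    intro ρ y t
    rw [lintegral_withDensity_eq_lintegral_mul _ (by fun_prop) (by fun_prop), laplace]
    refine lintegral_congr fun x => ?_
    rw [Pi.mul_apply, ← ENNReal.ofReal_mul (Real.exp_pos _).le, ← Real.exp_add, tip_add_left,
      tip_smul_left]
    congr 2; simp only [hg_def]; ring
  have key : ∀ y ∈ Zspace V, ∫ x, Complex.exp (tip y x * Complex.I) ∂μ' =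
      ∫ x, Complex.exp (tip y x * Complex.I) ∂ν' := by
    intro y hy
    obtain ⟨ε, hε, hpd⟩ := exists_pos_posDef_one_add_smul y hy.1
    have hP : ∀ t : ℝ, |t| < ε → 1 + (-t) • y ∈ Pcone V := fun t ht =>
      ⟨(Zsub V).add_mem one_mem_Z ((Zsub V).smul_mem _ hy), hpd _ (by rwa [abs_neg])⟩
    have h2 := complexMGF_eqOn_of_lintegral_exp (μ := μ') (ν := ν') (measurable_tip y) hε
      (fun t ht => by rw [hexp]; exact hfin _ (hP t ht))
      (fun t ht => by rw [hexp, hexp]; exact h _ (hP t ht))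
      (x := Complex.I) (by simp [hε])
    simpa only [ProbabilityTheory.complexMGF, mul_comm Complex.I] using h2
  let L : Mat r n →ₗ[ℝ] Mat r n →ₗ[ℝ] ℝ := LinearMap.mk₂ ℝ tip tip_add_left tip_smul_left
    tip_add_right tip_smul_right
  have hL : Continuous fun p : Mat r n × Mat r n => L p.1 p.2 :=
    (continuous_fst.matrix_mul continuous_snd).matrix_trace
  let _ : PseudoEMetricSpace (Mat r n) :=
    inferInstanceAs (PseudoEMetricSpace (Idx r n → Idx r n → ℝ))
  have : CompleteSpace (Mat r n) := inferInstanceAs (CompleteSpace (Idx r n → Idx r n → ℝ))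
  refine ext_of_integral_char_eq Real.continuous_probChar Real.probChar_ne_one (L := L)
    (fun v hv hLv => hv ?_) hL fun w => ?_
  · ext p q
    have h2 := LinearMap.congr_fun hLv (Matrix.single q p 1)
    simpa [L, tip, Matrix.trace_mul_single] using h2
  · simp only [BoundedContinuousFunction.char_apply, Real.probChar_apply]
    have hw : ∀ x ∈ Zspace V, L x w = tip (projZ V w) x := fun x hx => by
      rw [tip_comm, tip_projZ hx]; rfl
    rw [integral_congr_ae (haeμ.mono fun x hx => by rw [hw x hx]),
      integral_congr_ae (haeν.mono fun x hx => by rw [hw x hx])]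
    exact key _ (projZ_mem w)

theorem IsRiesz.unique (hV2 : CondV2 V) (hV3 : CondV3 V) {μ ν : Measure (Mat r n)}
    {s : Fin (r + 1) → ℝ} {C : ℝ} (hμ : IsRiesz V μ s C) (hν : IsRiesz V ν s C) : μ = ν := by
  refine ext_of_laplace hμ.compl_eq_zero hν.compl_eq_zero (fun θ hθ => ?_) fun θ hθ => ?_ <;>
    obtain ⟨T, hT, rfl⟩ := exists_cholesky hV2 hV3 hθ
  · rw [hμ.laplace_eq T hT]; exact ENNReal.ofReal_ne_top
  · rw [hμ.laplace_eq T hT, hν.laplace_eq T hT]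

theorem selRow_mul_transpose (k : Fin (r + 1)) : selRow n k * (selRow n k)ᵀ = 1 := by
  ext a b
  simp [selRow, Matrix.mul_apply, Matrix.one_apply, eq_comm]

theorem rowSp_mul_selRow_transpose {k : Fin (r + 1)} {B : Matrix (Fin (n k)) (Idx r n) ℝ}
    (hB : B ∈ rowSp V k) : B * (selRow n k)ᵀ = 0 := by
  ext a b
  simp [selRow, Matrix.mul_apply, rowSp_apply_eq_zero hB a (q := ⟨k, b⟩) (lt_irrefl k)]

theorem lowRow_mem_of_Z {x : Mat r n} (hx : x ∈ Zspace V) (k : Fin (r + 1)) :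
    lowRow k x ∈ rowSp V k := fun i =>
  ⟨fun h => by rw [col_lowRow_of_lt h]; exact hx.2.1 _ _ h, fun h => col_lowRow_of_not_lt h _⟩

theorem lowRow_sub (k : Fin (r + 1)) (x y : Mat r n) :
    lowRow k (x - y) = lowRow k x - lowRow k y := by
  ext a q
  by_cases h : q.1 < k <;> simp [lowRow, h]

theorem lowRow_smul_rowSp {k : Fin (r + 1)} {B : Matrix (Fin (n k)) (Idx r n) ℝ}
    (hB : B ∈ rowSp V k) {y : Mat r n} {v c : ℝ}
    (hy : selRow n k * y = v • (B + c • selRow n k)) : lowRow k y = v • B := by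
  ext a q
  have h := congrFun (congrFun hy a) q
  rw [selRow_mul_apply] at h
  by_cases hq : q.1 < k
  · have h0 : q ≠ ⟨k, a⟩ := fun e => by subst e; exact lt_irrefl _ hq
    simpa [lowRow, hq, selRow, h0] using h
  · simp [lowRow, hq, rowSp_apply_eq_zero hB a hq]

theorem blk_selRow_transpose_mul (k l i : Fin (r + 1)) (B : Matrix (Fin (n k)) (Idx r n) ℝ) :
    blk ((selRow n k)ᵀ * B) l i = (col (selRow n k) l)ᵀ * col B i := rfl

theorem blk_selRow_transpose_mul_of_ne {k l : Fin (r + 1)} (h : l ≠ k) (i : Fin (r + 1))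
    (B : Matrix (Fin (n k)) (Idx r n) ℝ) : blk ((selRow n k)ᵀ * B) l i = 0 := by
  rw [blk_selRow_transpose_mul, col_selRow_of_ne h, Matrix.transpose_zero, Matrix.zero_mul]

theorem blk_selRow_transpose_mul_self (k i : Fin (r + 1)) (B : Matrix (Fin (n k)) (Idx r n) ℝ) :
    blk ((selRow n k)ᵀ * B) k i = col B i := by
  rw [blk_selRow_transpose_mul, col_selRow_self, Matrix.transpose_one, Matrix.one_mul]

theorem blk_selRow_transpose_mul_diag {k : Fin (r + 1)} {B : Matrix (Fin (n k)) (Idx r n) ℝ}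
    (hB : B ∈ rowSp V k) (l : Fin (r + 1)) : blk ((selRow n k)ᵀ * B) l l = 0 := by
  by_cases h : l = k
  · subst h; rw [blk_selRow_transpose_mul_self]; exact (hB l).2 (lt_irrefl l)
  · exact blk_selRow_transpose_mul_of_ne h _ _

theorem selRow_transpose_mul_mem_lowT {k : Fin (r + 1)} {B : Matrix (Fin (n k)) (Idx r n) ℝ}
    (hB : B ∈ rowSp V k) : (selRow n k)ᵀ * B ∈ lowT V := by
  refine ⟨fun i l h => ?_, fun i l h => ?_, fun l => ⟨0, ?_⟩⟩
  · by_cases hl : l = k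
    · subst hl; rw [blk_selRow_transpose_mul_self]; exact (hB i).2 h.not_gt
    · exact blk_selRow_transpose_mul_of_ne hl _ _
  · by_cases hl : l = k
    · subst hl; rw [blk_selRow_transpose_mul_self]; exact (hB i).1 h
    · rw [blk_selRow_transpose_mul_of_ne hl]; exact zero_mem _
  · rw [blk_selRow_transpose_mul_diag hB, zero_smul]

theorem add_transpose_mem_Z {M : Mat r n} (hM : M ∈ lowT V) : M + Mᵀ ∈ Zspace V := by
  refine mem_Zspace_iff.2 ⟨Matrix.isSymm_add_transpose_self M, fun i l h => ?_, fun l => ?_⟩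
  · rw [blk_add, blk_transpose, hM.1 l i h, Matrix.transpose_zero, add_zero]
    exact hM.2.1 i l h
  · obtain ⟨c, hc⟩ := hM.2.2 l
    exact ⟨c + c, by rw [blk_add, blk_transpose, hc, Matrix.transpose_smul,
      Matrix.transpose_one, add_smul]⟩

theorem diagT_mem_Z (t : Fin (r + 1) → ℝ) : (diagT t : Mat r n) ∈ Zspace V := by
  refine mem_Zspace_iff.2 ⟨diagT_transpose t, fun i l h => (diagT_mem_lowT t).2.1 i l h,
    fun l => ⟨t l, ?_⟩⟩
  rw [lowT_diag (V := V) (diagT_mem_lowT t), tdiag_diagT]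

theorem fsq_eq_zero {m : Type*} [Fintype m] {M : Matrix m (Idx r n) ℝ} (h : fsq M = 0) :
    M = 0 := by
  rw [fsq_eq, Finset.sum_eq_zero_iff_of_nonneg fun a _ => by positivity] at h
  ext a q
  have h2 := (Finset.sum_eq_zero_iff_of_nonneg fun q _ => by positivity).1
    (h a (Finset.mem_univ a)) q (Finset.mem_univ q)
  simpa using h2

/-- The orthogonal projection onto `𝒵` keeps a block row that already has the right shape. -/
theorem row_projZ {k : Fin (r + 1)} {y : Mat r n} (hsymm : y.IsSymm) (hrow : lowRow k y ∈ rowSp V k)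
    {v : ℝ} (hv : blk y k k = v • 1) :
    lowRow k (projZ V y) = lowRow k y ∧ tdiag (projZ V y) k = v := by
  set z := y - projZ V y with hz
  have hpz := projZ_mem (V := V) y
  have hzs : z.IsSymm := hsymm.sub hpz.1
  have horth : ∀ θ ∈ Zspace V, tip θ z = 0 := fun θ hθ => by
    rw [hz, tip_sub_right, tip_projZ hθ, sub_self]
  constructor
  · set B := lowRow k z with hBdef
    have hB : B ∈ rowSp V k := by
      rw [hBdef, hz, lowRow_sub]
      exact sub_mem hrow (lowRow_mem_of_Z hpz k)
    have hθ : (selRow n k)ᵀ * B + Bᵀ * selRow n k ∈ Zspace V := by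
      simpa only [Matrix.transpose_mul, Matrix.transpose_transpose] using
        add_transpose_mem_Z (selRow_transpose_mul_mem_lowT hB)
    have h1 := horth _ hθ
    have h2 : tip ((selRow n k)ᵀ * B + Bᵀ * selRow n k) z = 2 * fsq B := by
      have e1 : tip ((selRow n k)ᵀ * B) z = fsq B := by
        rw [tip, Matrix.mul_assoc, Matrix.trace_mul_comm, Matrix.mul_assoc, ← hzs.eq,
          ← Matrix.transpose_mul, fsq_eq, Matrix.trace]
        refine Finset.sum_congr rfl fun a _ => Finset.sum_congr rfl fun q _ => ?_
        change B a q * (selRow n k * z) a q = B a q ^ 2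
        rw [selRow_mul_apply, hBdef]
        by_cases hq : q.1 < k <;> simp [lowRow, hq, sq]
      have e2 : tip (Bᵀ * selRow n k) z = tip ((selRow n k)ᵀ * B) z := by
        rw [tip, ← Matrix.trace_transpose, Matrix.transpose_mul, hzs.eq, Matrix.transpose_mul,
          Matrix.transpose_transpose, Matrix.trace_mul_comm, tip]
      rw [tip_add_left, e2, e1]; ring
    have h3 : B = 0 := by
      rw [h2, mul_eq_zero_iff_left two_ne_zero] at h1
      exact fsq_eq_zero h1
    rw [hBdef, hz, lowRow_sub, sub_eq_zero] at h3
    exact h3.symm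
  · have h1 := horth (diagT (Pi.single k 1)) (diagT_mem_Z _)
    have h2 : ∀ a : Fin (n k), z ⟨k, a⟩ ⟨k, a⟩ = v - tdiag (projZ V y) k := fun a => by
      have := congrFun (congrFun hv a) a
      have g := congrFun (congrFun (Z_diag hpz k) a) a
      simp only [blk_apply, Matrix.smul_apply, Matrix.one_apply_eq, smul_eq_mul, mul_one] at this g
      rw [hz, Matrix.sub_apply, this, g]
    have h3 : tip (diagT (Pi.single k 1)) z = n k * (v - tdiag (projZ V y) k) := by
      simp only [tip, diagT, Matrix.trace, Matrix.diag_apply, Matrix.diagonal_mul,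
        Fintype.sum_sigma]
      rw [Finset.sum_eq_single k (fun i _ hi => by simp [hi]) (by simp)]
      simp [h2, mul_sub]
    have hn : (n k : ℝ) ≠ 0 := by exact_mod_cast (n k).ne_zero
    rw [h1, eq_comm, mul_eq_zero_iff_left hn] at h3
    linarith

/-- `1 + B`, with the block row `B` placed in row `k`. -/
def rowShear (k : Fin (r + 1)) (B : Matrix (Fin (n k)) (Idx r n) ℝ) : Mat r n :=
  1 + (selRow n k)ᵀ * B

section rowShear

variable {k : Fin (r + 1)} {B : Matrix (Fin (n k)) (Idx r n) ℝ}

theorem tdiag_rowShear (hB : B ∈ rowSp V k) (i : Fin (r + 1)) : tdiag (rowShear k B) i = 1 := by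
  refine tdiag_eq ?_
  rw [rowShear, blk_add, blk_one_self, blk_selRow_transpose_mul_diag hB, add_zero, one_smul]

theorem rowShear_mem_Hgrp (hB : B ∈ rowSp V k) : rowShear k B ∈ Hgrp V :=
  mem_Hgrp_iff.2 ⟨add_mem one_mem_lowT (selRow_transpose_mul_mem_lowT hB), fun i => by
    rw [tdiag_rowShear hB]; exact one_pos⟩

theorem chi_rowShear (hB : B ∈ rowSp V k) (s : Fin (r + 1) → ℝ) : chi s (rowShear k B) = 1 := by
  simp [chi, tdiag_rowShear hB]

theorem rowSp_mul_rowShear {A : Matrix (Fin (n k)) (Idx r n) ℝ} (hA : A ∈ rowSp V k) :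
    A * rowShear k B = A := by
  rw [rowShear, Matrix.mul_add, Matrix.mul_one, ← Matrix.mul_assoc, rowSp_mul_selRow_transpose hA,
    Matrix.zero_mul, add_zero]

theorem selRow_mul_rowShear : selRow n k * rowShear k B = B + selRow n k := by
  rw [rowShear, Matrix.mul_add, Matrix.mul_one, ← Matrix.mul_assoc, selRow_mul_transpose,
    Matrix.one_mul, add_comm]

end rowShear

/-- The normalized strictly lower part of the block row `k`. -/
noncomputable def aRow (k : Fin (r + 1)) (x : Mat r n) : Matrix (Fin (n k)) (Idx r n) ℝ :=
  (tdiag x k)⁻¹ • lowRow k x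

/-- The normalized block row `k`. -/
noncomputable def pRow (k : Fin (r + 1)) (x : Mat r n) : Matrix (Fin (n k)) (Idx r n) ℝ :=
  aRow k x + selRow n k

/-- The Schur complement of the block `k`. -/
noncomputable def schur (k : Fin (r + 1)) (x : Mat r n) : Mat r n :=
  x - tdiag x k • ((pRow k x)ᵀ * pRow k x)

section schur

variable {k : Fin (r + 1)} {x : Mat r n}

theorem tip_eq_schur (T : Mat r n) :
    tip (T * Tᵀ) x = tip (T * Tᵀ) (schur k x) + tdiag x k * fsq (pRow k x * T) := by
  rw [schur, tip_sub_right, tip_smul_right, tip_gram]; ring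

theorem aRow_mem (hx : x ∈ Zspace V) : aRow k x ∈ rowSp V k :=
  Submodule.smul_mem _ _ (lowRow_mem_of_Z hx k)

theorem schur_isSymm (hx : x ∈ Zspace V) : (schur k x).IsSymm := by
  rw [schur, Matrix.IsSymm, Matrix.transpose_sub, hx.1.eq, Matrix.transpose_smul,
    Matrix.transpose_mul, Matrix.transpose_transpose]

theorem selRow_mul_eq_pRow (hx : x ∈ Zspace V) (ht : trunc (k.1 + 1) x = x) (hv : 0 < tdiag x k) :
    selRow n k * x = tdiag x k • pRow k x := by
  ext a q
  rw [selRow_mul_apply]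
  rcases lt_trichotomy q.1 k with h | h | h
  · have hq : q ≠ ⟨k, a⟩ := fun e => by subst e; exact lt_irrefl _ h
    simp [pRow, aRow, lowRow, selRow, h, hq, hv.ne']
  · obtain ⟨i, b⟩ := q
    simp only at h
    subst h
    have := congrFun (congrFun (Z_diag hx i) a) b
    rw [blk_apply] at this
    rw [this]
    simp [pRow, aRow, lowRow, selRow, Matrix.one_apply, eq_comm]
  · have hq : q ≠ ⟨k, a⟩ := fun e => by subst e; exact lt_irrefl _ h
    have h' : ¬ q.1.1 < k.1 + 1 := by
      have : k.1 < q.1.1 := h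
      omega
    rw [← ht, trunc_apply, if_neg fun hh => h' hh.2, ht]
    simp [pRow, aRow, lowRow, selRow, h.not_gt, hq]

theorem pRow_mul_selRow_transpose (hx : x ∈ Zspace V) : pRow k x * (selRow n k)ᵀ = 1 := by
  rw [pRow, Matrix.add_mul, rowSp_mul_selRow_transpose (aRow_mem hx), selRow_mul_transpose,
    zero_add]

theorem schur_mul_selRow_transpose (hx : x ∈ Zspace V) (ht : trunc (k.1 + 1) x = x)
    (hv : 0 < tdiag x k) : schur k x * (selRow n k)ᵀ = 0 := by
  have h1 : x * (selRow n k)ᵀ = tdiag x k • (pRow k x)ᵀ := by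
    rw [← Matrix.transpose_smul, ← selRow_mul_eq_pRow hx ht hv, Matrix.transpose_mul, hx.1.eq]
  rw [schur, Matrix.sub_mul, h1, Matrix.smul_mul, Matrix.mul_assoc, pRow_mul_selRow_transpose hx,
    Matrix.mul_one, sub_self]

theorem schur_mul_rowShear (hx : x ∈ Zspace V) (ht : trunc (k.1 + 1) x = x)
    (hv : 0 < tdiag x k) (B : Matrix (Fin (n k)) (Idx r n) ℝ) :
    schur k x * rowShear k B = schur k x := by
  rw [rowShear, Matrix.mul_add, Matrix.mul_one, ← Matrix.mul_assoc,
    schur_mul_selRow_transpose hx ht hv, Matrix.zero_mul, add_zero]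

theorem rowShear_transpose_mul_mul (hx : x ∈ Zspace V) (ht : trunc (k.1 + 1) x = x)
    (hv : 0 < tdiag x k) (B : Matrix (Fin (n k)) (Idx r n) ℝ) :
    (rowShear k B)ᵀ * x * rowShear k B = schur k x +
      tdiag x k • ((aRow k x + B + selRow n k)ᵀ * (aRow k x + B + selRow n k)) := by
  have h1 : x = schur k x + tdiag x k • ((pRow k x)ᵀ * pRow k x) := by rw [schur]; abel
  have h2 : pRow k x * rowShear k B = aRow k x + B + selRow n k := by
    rw [pRow, Matrix.add_mul, rowSp_mul_rowShear (aRow_mem hx), selRow_mul_rowShear, add_assoc]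
  have h3 : (rowShear k B)ᵀ * schur k x = schur k x := by
    have := schur_mul_rowShear hx ht hv B
    rw [← (schur_isSymm hx).eq, ← Matrix.transpose_mul, this]
  conv_lhs => rw [h1]
  rw [Matrix.mul_add, Matrix.add_mul, h3, schur_mul_rowShear hx ht hv, Matrix.mul_smul,
    Matrix.smul_mul, ← h2, Matrix.transpose_mul]
  simp only [Matrix.mul_assoc]

variable (V) in
/-- The dual action of `rowShear k B` on `𝒵`. -/
noncomputable def shear (k : Fin (r + 1)) (B : Matrix (Fin (n k)) (Idx r n) ℝ) (x : Mat r n) :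
    Mat r n :=
  projZ V ((rowShear k B)ᵀ * x * rowShear k B)

theorem tip_shear (hV2 : CondV2 V) (hV3 : CondV3 V)
    (B : Matrix (Fin (n k)) (Idx r n) ℝ) {T : Mat r n} (hT : T ∈ Hgrp V) :
    tip (T * Tᵀ) (shear V k B x) = tip ((rowShear k B * T) * (rowShear k B * T)ᵀ) x := by
  rw [shear, tip_projZ (mul_transpose_mem_Z hV2 hV3 (mem_Hgrp_iff.1 hT).1), tip, tip,
    Matrix.transpose_mul, Matrix.trace_mul_comm]
  simp only [Matrix.mul_assoc]
  rw [Matrix.trace_mul_comm]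
  simp only [Matrix.mul_assoc]
  rw [Matrix.trace_mul_comm]
  simp only [Matrix.mul_assoc]

theorem shear_row (hx : x ∈ Zspace V) (ht : trunc (k.1 + 1) x = x)
    (hv : 0 < tdiag x k) {B : Matrix (Fin (n k)) (Idx r n) ℝ} (hB : B ∈ rowSp V k) :
    tdiag (shear V k B x) k = tdiag x k ∧ aRow k (shear V k B x) = aRow k x + B := by
  have hA := add_mem (aRow_mem (k := k) hx) hB
  have h1 : selRow n k * ((rowShear k B)ᵀ * x * rowShear k B) =
      tdiag x k • (aRow k x + B + (1 : ℝ) • selRow n k) := by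
    have h2 : selRow n k * schur k x = 0 := by
      have := congrArg Matrix.transpose (schur_mul_selRow_transpose hx ht hv)
      rwa [Matrix.transpose_mul, Matrix.transpose_transpose, (schur_isSymm hx).eq,
        Matrix.transpose_zero] at this
    have h3 : selRow n k * (aRow k x + B + selRow n k)ᵀ = 1 := by
      rw [← Matrix.transpose_transpose (selRow n k * _), Matrix.transpose_mul,
        Matrix.transpose_transpose, Matrix.add_mul, rowSp_mul_selRow_transpose hA,
        selRow_mul_transpose, zero_add, Matrix.transpose_one]
    rw [rowShear_transpose_mul_mul hx ht hv, Matrix.mul_add, h2, zero_add, Matrix.mul_smul,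
      ← Matrix.mul_assoc, h3, Matrix.one_mul, one_smul]
  have hlow := lowRow_smul_rowSp hA h1
  have hsymm : ((rowShear k B)ᵀ * x * rowShear k B).IsSymm := by
    rw [Matrix.IsSymm, Matrix.transpose_mul, Matrix.transpose_mul, Matrix.transpose_transpose,
      hx.1.eq, Matrix.mul_assoc]
  have hd : blk ((rowShear k B)ᵀ * x * rowShear k B) k k = tdiag x k • 1 := by
    rw [← col_selRow_mul, h1]
    change tdiag x k • (col (aRow k x + B) k + (1 : ℝ) • col (selRow n k) k) = _
    rw [(hA k).2 (lt_irrefl k), col_selRow_self, one_smul, zero_add]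
  obtain ⟨g1, g2⟩ := row_projZ hsymm (by rw [hlow]; exact Submodule.smul_mem _ _ hA) hd
  refine ⟨g2, ?_⟩
  rw [aRow, shear, g2, g1, hlow, smul_smul, inv_mul_cancel₀ hv.ne', one_smul]

theorem tip_schur_shear (hV2 : CondV2 V) (hV3 : CondV3 V)
    (hx : x ∈ Zspace V) (ht : trunc (k.1 + 1) x = x)
    (hv : 0 < tdiag x k) {B : Matrix (Fin (n k)) (Idx r n) ℝ} (hB : B ∈ rowSp V k)
    {T : Mat r n} (hT : T ∈ Hgrp V) :
    tip (T * Tᵀ) (schur k (shear V k B x)) = tip (T * Tᵀ) (schur k x) := by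
  obtain ⟨g1, g2⟩ := shear_row hx ht hv hB
  have h1 := tip_eq_schur (k := k) (x := shear V k B x) T
  have h2 : tip (T * Tᵀ) (shear V k B x) = tip (T * Tᵀ) (schur k x) +
      tdiag x k * fsq ((aRow k x + B + selRow n k) * T) := by
    rw [shear, tip_projZ (mul_transpose_mem_Z hV2 hV3 (mem_Hgrp_iff.1 hT).1),
      rowShear_transpose_mul_mul hx ht hv, tip_add_right, tip_smul_right, tip_gram]
  rw [pRow, g1, g2, h2] at h1
  exact (add_right_cancel h1).symm

end schur

@[fun_prop]
theorem measurable_tdiag (k : Fin (r + 1)) : Measurable fun x : Mat r n => tdiag x k :=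
  (measurable_pi_apply _).comp (measurable_pi_apply (X := fun _ : Idx r n => Idx r n → ℝ) _)

theorem measurable_entry (p q : Idx r n) : Measurable fun x : Mat r n => x p q :=
  (measurable_pi_apply _).comp (measurable_pi_apply (X := fun _ : Idx r n => Idx r n → ℝ) _)

@[fun_prop]
theorem measurable_aRow (k : Fin (r + 1)) :
    Measurable (aRow k : Mat r n → Matrix (Fin (n k)) (Idx r n) ℝ) := by
  refine measurable_pi_lambda _ fun a => measurable_pi_lambda _ fun q => ?_
  change Measurable fun x : Mat r n => (tdiag x k)⁻¹ * (if q.1 < k then x ⟨k, a⟩ q else 0)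
  split_ifs
  · exact (measurable_tdiag k).inv.mul (measurable_entry _ _)
  · exact (measurable_tdiag k).inv.mul measurable_const

@[fun_prop]
theorem measurable_schur (k : Fin (r + 1)) : Measurable (schur k : Mat r n → Mat r n) := by
  have h : Continuous fun p : Mat r n × ℝ × Matrix (Fin (n k)) (Idx r n) ℝ =>
      p.1 - p.2.1 • ((p.2.2 + selRow n k)ᵀ * (p.2.2 + selRow n k)) := by
    have h1 : Continuous fun p : Mat r n × ℝ × Matrix (Fin (n k)) (Idx r n) ℝ =>
      p.2.2 + selRow n k := by fun_prop
    exact continuous_fst.sub (continuous_snd.fst.smul (h1.matrix_transpose.matrix_mul h1))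
  exact h.measurable.comp (measurable_id.prodMk ((measurable_tdiag k).prodMk (measurable_aRow k)))

variable (V) in
@[fun_prop]
theorem measurable_shear (k : Fin (r + 1)) (B : Matrix (Fin (n k)) (Idx r n) ℝ) :
    Measurable (shear V k B) :=
  (measurable_projZ V).comp
    ((continuous_const.matrix_mul continuous_id).matrix_mul continuous_const).measurable

namespace IsRiesz

variable {μ : Measure (Mat r n)} {s : Fin (r + 1) → ℝ} {C : ℝ} {k : Fin (r + 1)}

theorem map_shear (hV1 : CondV1 V) (hV2 : CondV2 V) (hV3 : CondV3 V) (h : IsRiesz V μ s C)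
    {B : Matrix (Fin (n k)) (Idx r n) ℝ} (hB : B ∈ rowSp V k) : μ.map (shear V k B) = μ := by
  refine IsRiesz.unique (C := C) (s := s) hV2 hV3 ⟨?_, h.pos, fun T hT => ?_⟩ h
  · rw [Measure.map_apply (by fun_prop) (measurableSet_Zspace V).compl]
    convert measure_empty (μ := μ)
    ext x
    simp [shear, projZ_mem]
  · have hU := rowShear_mem_Hgrp hB
    rw [laplace_map (by fun_prop)]
    simp only [tip_shear hV2 hV3 B hT]
    have := h.laplace_eq _ (Hgrp_mul hV1 hU hT)
    rw [laplace, chi_mul _ hU hT, chi_rowShear hB, one_mul] at this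
    exact this

theorem lintegral_shift (hV1 : CondV1 V) (hV2 : CondV2 V) (hV3 : CondV3 V) (h : IsRiesz V μ s C)
    (ht : ∀ᵐ x ∂μ, trunc (k.1 + 1) x = x) (hv : ∀ᵐ x ∂μ, 0 < tdiag x k)
    {T : Mat r n} (hT : T ∈ Hgrp V) {B : Matrix (Fin (n k)) (Idx r n) ℝ} (hB : B ∈ rowSp V k)
    {Q : ℝ × Matrix (Fin (n k)) (Idx r n) ℝ → ℝ≥0∞} (hQ : Measurable Q) :
    ∫⁻ x, ENNReal.ofReal (Real.exp (-(tip (T * Tᵀ) (schur k x)))) *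
        Q (tdiag x k, aRow k x + B) ∂μ =
      ∫⁻ x, ENNReal.ofReal (Real.exp (-(tip (T * Tᵀ) (schur k x)))) *
        Q (tdiag x k, aRow k x) ∂μ := by
  have hm : Measurable fun x => ENNReal.ofReal (Real.exp (-(tip (T * Tᵀ) (schur k x)))) *
      Q (tdiag x k, aRow k x) := by
    have : Measurable fun x : Mat r n => Q (tdiag x k, aRow k x) :=
      hQ.comp ((measurable_tdiag k).prodMk (measurable_aRow k))
    fun_prop
  conv_rhs => rw [← h.map_shear hV1 hV2 hV3 hB, lintegral_map hm (by fun_prop)]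
  refine lintegral_congr_ae ?_
  filter_upwards [h.ae_mem, ht, hv] with x hx htx hvx
  obtain ⟨g1, g2⟩ := shear_row hx htx hvx hB
  rw [g1, g2, tip_schur_shear hV2 hV3 hx htx hvx hB hT]

theorem lintegral_schur_aux (hV1 : CondV1 V) (hV2 : CondV2 V) (hV3 : CondV3 V)
    (h : IsRiesz V μ s C)
    (ht : ∀ᵐ x ∂μ, trunc (k.1 + 1) x = x) (hv : ∀ᵐ x ∂μ, 0 < tdiag x k)
    {T : Mat r n} (hT : T ∈ Hgrp V) {p : Matrix (Fin (n k)) (Idx r n) ℝ → ℝ≥0∞}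
    {q : ℝ × Matrix (Fin (n k)) (Idx r n) ℝ → ℝ≥0∞} (hp : Measurable p) (hq : Measurable q)
    (hneg : ∀ B, p (-B) = p B) :
    (∫⁻ b, p (rowOf V k b)) * ∫⁻ x, ENNReal.ofReal (Real.exp (-(tip (T * Tᵀ) (schur k x)))) *
        q (tdiag x k, aRow k x) ∂μ =
      ∫⁻ x, ENNReal.ofReal (Real.exp (-(tip (T * Tᵀ) (schur k x)))) * (p (aRow k x) *
        ∫⁻ b, q (tdiag x k, rowOf V k b)) ∂μ := by
  have := h.sFinite
  set F : Mat r n → ℝ≥0∞ := fun x => ENNReal.ofReal (Real.exp (-(tip (T * Tᵀ) (schur k x))))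
    with hFdef
  have hF : Measurable F := by fun_prop
  have hx1 : Measurable fun z : (RowIdx V k → ℝ) × Mat r n => z.2 := measurable_snd
  have hr : Measurable fun z : (RowIdx V k → ℝ) × Mat r n => rowOf V k z.1 :=
    (measurable_rowOf V k).comp measurable_fst
  have ha : Measurable fun z : (RowIdx V k → ℝ) × Mat r n => aRow k z.2 :=
    (measurable_aRow k).comp measurable_snd
  have hd : Measurable fun z : (RowIdx V k → ℝ) × Mat r n => tdiag z.2 k :=
    (measurable_tdiag k).comp measurable_snd
  have hadd : Measurable fun z : (RowIdx V k → ℝ) × Mat r n => aRow k z.2 + rowOf V k z.1 := by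
    have : Measurable fun w : Matrix (Fin (n k)) (Idx r n) ℝ × Matrix (Fin (n k)) (Idx r n) ℝ =>
      w.1 + w.2 := (continuous_fst.add continuous_snd).measurable
    exact this.comp (ha.prodMk hr)
  have hsub : Measurable fun z : (RowIdx V k → ℝ) × Mat r n => rowOf V k z.1 - aRow k z.2 := by
    have : Measurable fun w : Matrix (Fin (n k)) (Idx r n) ℝ × Matrix (Fin (n k)) (Idx r n) ℝ =>
      w.1 - w.2 := (continuous_fst.sub continuous_snd).measurable
    exact this.comp (hr.prodMk ha)
  have hm1 : Measurable fun z : (RowIdx V k → ℝ) × Mat r n =>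
      F z.2 * (p (rowOf V k z.1) * q (tdiag z.2 k, aRow k z.2 + rowOf V k z.1)) :=
    (hF.comp hx1).mul ((hp.comp hr).mul (hq.comp (hd.prodMk hadd)))
  have hm2 : Measurable fun z : (RowIdx V k → ℝ) × Mat r n =>
      F z.2 * (p (rowOf V k z.1 - aRow k z.2) * q (tdiag z.2 k, rowOf V k z.1)) :=
    (hF.comp hx1).mul ((hp.comp hsub).mul (hq.comp (hd.prodMk hr)))
  have hm3 : Measurable fun z : (RowIdx V k → ℝ) × Mat r n =>
      F z.2 * (p (aRow k z.2) * q (tdiag z.2 k, rowOf V k z.1)) :=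
    (hF.comp hx1).mul ((hp.comp ha).mul (hq.comp (hd.prodMk hr)))
  calc (∫⁻ b, p (rowOf V k b)) * ∫⁻ x, F x * q (tdiag x k, aRow k x) ∂μ
      = ∫⁻ b, ∫⁻ x, F x * (p (rowOf V k b) * q (tdiag x k, aRow k x + rowOf V k b)) ∂μ := by
        have hpm : Measurable fun b => p (rowOf V k b) := hp.comp (measurable_rowOf V k)
        rw [← lintegral_mul_const _ hpm]
        refine lintegral_congr fun b => ?_
        rw [h.lintegral_shift hV1 hV2 hV3 ht hv hT (rowOf_mem k b)
          (Q := fun z => p (rowOf V k b) * q z) (hq.const_mul _),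
          ← lintegral_const_mul]
        · exact lintegral_congr fun x => by ring
        · exact hF.mul (hq.comp ((measurable_tdiag k).prodMk (measurable_aRow k)))
    _ = ∫⁻ x, F x * (∫⁻ b : RowIdx V k → ℝ,
        p (rowOf V k b) * q (tdiag x k, aRow k x + rowOf V k b)) ∂μ := by
        rw [lintegral_lintegral_swap hm1.aemeasurable]
        refine lintegral_congr fun x => ?_
        rw [lintegral_const_mul' _ _ ENNReal.ofReal_ne_top]
    _ = ∫⁻ x, F x * (∫⁻ b : RowIdx V k → ℝ,
        p (rowOf V k b - aRow k x) * q (tdiag x k, rowOf V k b)) ∂μ := by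
        refine lintegral_congr_ae ?_
        filter_upwards [h.ae_mem] with x hx
        obtain ⟨a, ha⟩ := exists_rowOf (aRow_mem (k := k) hx)
        rw [← lintegral_add_left_eq_self
          (fun b => p (rowOf V k b - aRow k x) * q (tdiag x k, rowOf V k b)) a]
        simp only [← ha, map_add, add_sub_cancel_left]
    _ = ∫⁻ b, ∫⁻ x, F x * (p (rowOf V k b - aRow k x) * q (tdiag x k, rowOf V k b)) ∂μ := by
        rw [lintegral_lintegral_swap hm2.aemeasurable]
        refine lintegral_congr fun x => ?_
        rw [lintegral_const_mul' _ _ ENNReal.ofReal_ne_top]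
    _ = ∫⁻ b, ∫⁻ x, F x * (p (aRow k x) * q (tdiag x k, rowOf V k b)) ∂μ := by
        refine lintegral_congr fun b => ?_
        have hQ : Measurable fun z : ℝ × Matrix (Fin (n k)) (Idx r n) ℝ =>
            p (rowOf V k b - z.2) * q (z.1, rowOf V k b) := by
          have h1 : Measurable fun z : ℝ × Matrix (Fin (n k)) (Idx r n) ℝ =>
            rowOf V k b - z.2 := (continuous_const.sub continuous_snd).measurable
          exact (hp.comp h1).mul (hq.comp (measurable_fst.prodMk measurable_const))
        rw [← h.lintegral_shift hV1 hV2 hV3 ht hv hT (rowOf_mem k b) hQ]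
        refine lintegral_congr fun x => ?_
        simp only [sub_add_cancel_right, hneg, hFdef]
    _ = _ := by
        rw [lintegral_lintegral_swap hm3.aemeasurable]
        refine lintegral_congr fun x => ?_
        rw [lintegral_const_mul' _ _ ENNReal.ofReal_ne_top]
        congr 1
        rw [lintegral_const_mul]
        exact hq.comp (measurable_const.prodMk (measurable_rowOf V k))

end IsRiesz

theorem schur_mul_diagT_single {k : Fin (r + 1)} {x : Mat r n} (hx : x ∈ Zspace V)
    (ht : trunc (k.1 + 1) x = x) (hv : 0 < tdiag x k) :
    schur k x * diagT (Pi.single k 1) = 0 := by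
  have h := schur_mul_selRow_transpose hx ht hv
  ext p q
  rw [diagT, Matrix.mul_diagonal]
  by_cases hq : q.1 = k
  · obtain ⟨i, b⟩ := q
    obtain rfl : i = k := hq
    have h1 := congrFun (congrFun h p) b
    rw [Matrix.mul_apply, Finset.sum_eq_single (⟨i, b⟩ : Idx r n)] at h1
    · simpa [selRow] using h1
    · intro j _ hj
      simp [selRow, hj]
    · simp
  · simp [hq]

theorem selRow_mul_diagT (k : Fin (r + 1)) (t : Fin (r + 1) → ℝ) :
    selRow n k * (diagT t : Mat r n) = t k • selRow n k := by
  ext a q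
  rw [diagT, Matrix.mul_diagonal]
  by_cases hq : q = ⟨k, a⟩
  · subst hq; simp [selRow]
  · simp [selRow, hq]

theorem diagT_one : (diagT 1 : Mat r n) = 1 := by
  simp [diagT]

theorem tip_mul_transpose_of_mul_eq {S D : Mat r n} (hS : S.IsSymm) (hD : D.IsSymm)
    (h : S * D = S) (T : Mat r n) : tip (T * Tᵀ) S = tip ((D * T) * (D * T)ᵀ) S := by
  have h' : D * S = S := by
    have := congrArg Matrix.transpose h
    rwa [Matrix.transpose_mul, hS.eq, hD.eq] at this
  rw [tip, tip, Matrix.transpose_mul, hD.eq]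
  calc (T * Tᵀ * S).trace = (T * Tᵀ * (D * S * D)).trace := by rw [h', h]
    _ = (D * (T * Tᵀ * D * S)).trace := by
      rw [Matrix.trace_mul_comm D]; simp only [Matrix.mul_assoc]
    _ = _ := by simp only [Matrix.mul_assoc]

/-- The matrix `T` with its `k`-th block row replaced by that of the identity. -/
def resetRow (k : Fin (r + 1)) (T : Mat r n) : Mat r n :=
  diagT (1 - Pi.single k 1) * T + diagT (Pi.single k 1)

theorem tdiag_resetRow (k i : Fin (r + 1)) (T : Mat r n) :
    tdiag (resetRow k T) i = if i = k then 1 else tdiag T i := by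
  have h : tdiag (resetRow k T) i =
      (1 - Pi.single k 1 : Fin (r + 1) → ℝ) i * tdiag T i +
        (Pi.single k 1 : Fin (r + 1) → ℝ) i := by
    simp [resetRow, tdiag, diagT]
  rw [h]
  split_ifs with hi
  · subst hi; simp
  · simp [hi]

theorem resetRow_mem_Hgrp (k : Fin (r + 1)) {T : Mat r n} (hT : T ∈ Hgrp V) :
    resetRow k T ∈ Hgrp V := by
  rw [mem_Hgrp_iff] at *
  refine ⟨?_, fun i => ?_⟩
  · have h := diagT_lowT_diagT hT.1 (1 - Pi.single k 1) 1
    rw [diagT_one, Matrix.mul_one] at h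
    exact (lowT V).add_mem h (diagT_mem_lowT _)
  · rw [tdiag_resetRow]
    split_ifs
    · exact one_pos
    · exact hT.2 i

theorem selRow_mul_resetRow (k : Fin (r + 1)) (T : Mat r n) :
    selRow n k * resetRow k T = selRow n k := by
  rw [resetRow, Matrix.mul_add, ← Matrix.mul_assoc, selRow_mul_diagT, selRow_mul_diagT]
  simp

theorem tip_schur_resetRow {k : Fin (r + 1)} {x : Mat r n} (hx : x ∈ Zspace V)
    (ht : trunc (k.1 + 1) x = x) (hv : 0 < tdiag x k) (T : Mat r n) :
    tip (T * Tᵀ) (schur k x) = tip (resetRow k T * (resetRow k T)ᵀ) (schur k x) := by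
  have hD : schur k x * diagT (1 - Pi.single k 1) = schur k x := by
    have h1 : (diagT (1 - Pi.single k 1) : Mat r n) = 1 - diagT (Pi.single k 1) := by
      rw [← diagT_one]; ext p q; simp only [diagT, Matrix.diagonal_apply, Matrix.sub_apply]
      split_ifs <;> simp
    rw [h1, Matrix.mul_sub, schur_mul_diagT_single hx ht hv, Matrix.mul_one, sub_zero]
  have hs := diagT_transpose (n := n) (1 - Pi.single k 1)
  rw [tip_mul_transpose_of_mul_eq (schur_isSymm hx) hs hD T,
    tip_mul_transpose_of_mul_eq (schur_isSymm hx) hs hD (resetRow k T)]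
  have : (diagT (1 - Pi.single k 1) : Mat r n) * resetRow k T = diagT (1 - Pi.single k 1) * T := by
    have e1 : ((1 - Pi.single k 1) * (1 - Pi.single k 1) : Fin (r + 1) → ℝ) =
        1 - Pi.single k 1 := by
      ext i; by_cases hi : i = k
      · subst hi; simp
      · simp [hi]
    have e2 : ((1 - Pi.single k 1) * Pi.single k 1 : Fin (r + 1) → ℝ) = 0 := by
      ext i; by_cases hi : i = k
      · subst hi; simp
      · simp [hi]
    rw [resetRow, Matrix.mul_add, ← Matrix.mul_assoc, diagT_mul, diagT_mul, e1, e2]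
    simp [diagT]
  rw [this]

/-- The exponent left after the `k`-th coordinate of a Riesz measure is integrated out. -/
noncomputable def dropParam
    (V : ∀ l k : Fin (r + 1), Submodule ℝ (Matrix (Fin (n l)) (Fin (n k)) ℝ))
    (k : Fin (r + 1)) (s : Fin (r + 1) → ℝ) (i : Fin (r + 1)) : ℝ :=
  if i = k then 0 else s i - halfDim V k i

theorem chi_resetRow (k : Fin (r + 1)) (s : Fin (r + 1) → ℝ) {T : Mat r n} (hT : T ∈ Hgrp V) :
    chi (-s) (resetRow k T) =
      chi (-(dropParam V k s)) T * chi (-halfDim V k) (resetRow k T) := by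
  rw [chi, chi, chi, ← Finset.prod_mul_distrib]
  refine Finset.prod_congr rfl fun i _ => ?_
  rw [tdiag_resetRow]
  split_ifs with hi
  · simp [hi, dropParam]
  · rw [← Real.rpow_add ((mem_Hgrp_iff.1 hT).2 i)]
    simp only [Pi.neg_apply, dropParam, if_neg hi]
    congr 1; ring

theorem tip_resetRow {k : Fin (r + 1)} {x : Mat r n} (hV1 : CondV1 V) (hx : x ∈ Zspace V)
    {T : Mat r n} (hT : T ∈ Hgrp V) :
    tip (resetRow k T * (resetRow k T)ᵀ) x =
      tip (resetRow k T * (resetRow k T)ᵀ) (schur k x) +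
        tdiag x k * (fsq (aRow k x * resetRow k T) + n k) := by
  have h := rowSp_mul hV1 (aRow_mem (k := k) hx) (mem_Hgrp_iff.1 (resetRow_mem_Hgrp k hT)).1
  have h1 := fsq_add_smul_selRow h 1
  rw [one_smul, one_pow, mul_one] at h1
  rw [tip_eq_schur (k := k), pRow, Matrix.add_mul, selRow_mul_resetRow, h1]

theorem lintegral_exp_neg_mul_fsq (hV1 : CondV1 V) {k : Fin (r + 1)} {T : Mat r n}
    (hT : T ∈ Hgrp V) {v : ℝ} (hv : 0 < v) (c : ℝ) :
    ∫⁻ b : RowIdx V k → ℝ, ENNReal.ofReal (Real.exp (-(v * (fsq (rowOf V k b * T) + c)))) =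
      ENNReal.ofReal (Real.exp (-(v * c)) * √v ^ (2 * ∑ i, (-halfDim V k) i)) *
        (ENNReal.ofReal (chi (-halfDim V k) T) * gaussK V k) := by
  have hs := Real.sqrt_pos.2 hv
  have h := lintegral_rowOf_mul_add hV1 (smul_mem_Hgrp hs hT) (zero_mem (rowSp V k))
  rw [chi_smul _ hs hT, ENNReal.ofReal_mul (by positivity)] at h
  have e : ∀ b : RowIdx V k → ℝ, ENNReal.ofReal (Real.exp (-(v * (fsq (rowOf V k b * T) + c)))) =
      ENNReal.ofReal (Real.exp (-(v * c))) *
        ENNReal.ofReal (Real.exp (-fsq (rowOf V k b * (√v • T) + 0))) := fun b => by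
    rw [← ENNReal.ofReal_mul (Real.exp_pos _).le, ← Real.exp_add, add_zero, Matrix.mul_smul,
      fsq_smul, Real.sq_sqrt hv.le]
    congr 2; ring
  simp only [e]
  rw [lintegral_const_mul' _ _ ENNReal.ofReal_ne_top, h, ENNReal.ofReal_mul (Real.exp_pos _).le]
  ring

namespace IsRiesz

variable {μ : Measure (Mat r n)} {s : Fin (r + 1) → ℝ} {C : ℝ} {k : Fin (r + 1)}

theorem exists_dropParam (hV1 : CondV1 V) (hV2 : CondV2 V) (hV3 : CondV3 V) (h : IsRiesz V μ s C)
    (ht : ∀ᵐ x ∂μ, trunc (k.1 + 1) x = x) (hv : ∀ᵐ x ∂μ, 0 < tdiag x k) :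
    ∃ ν, IsRiesz V ν (dropParam V k s) C := by
  have hg : Measurable fun x : Mat r n => projZ V (schur k x) :=
    (measurable_projZ V).comp (measurable_schur k)
  set w : Mat r n → ℝ≥0∞ := fun x => ENNReal.ofReal (Real.exp (-fsq (aRow k x))) *
    ENNReal.ofReal (Real.exp (-(tdiag x k * n k)) *
      √(tdiag x k) ^ (2 * ∑ i, (-halfDim V k) i)) with hw
  have hfa : Measurable fun x : Mat r n => fsq (aRow k x) :=
    measurable_fsq.comp (measurable_aRow k)
  have hwm : Measurable w := by fun_prop
  refine ⟨(μ.withDensity w).map fun x => projZ V (schur k x), ?_, h.pos, fun T hT => ?_⟩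
  · rw [Measure.map_apply hg (measurableSet_Zspace V).compl]
    convert measure_empty (μ := μ.withDensity w)
    ext x
    simp [projZ_mem]
  · have hT' := resetRow_mem_Hgrp k hT
    rw [laplace_map hg,
      lintegral_withDensity_eq_lintegral_mul _ hwm (by
        have : Measurable fun x => tip (T * Tᵀ) (projZ V (schur k x)) :=
          (measurable_tip _).comp hg
        fun_prop)]
    have hq : Measurable fun z : ℝ × Matrix (Fin (n k)) (Idx r n) ℝ =>
        ENNReal.ofReal (Real.exp (-(z.1 * (fsq (z.2 * resetRow k T) + n k)))) := by
      have : Measurable fun z : ℝ × Matrix (Fin (n k)) (Idx r n) ℝ => fsq (z.2 * resetRow k T) :=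
        (continuous_fsq.comp (continuous_snd.matrix_mul continuous_const)).measurable
      exact ((measurable_fst.mul (this.add_const _)).neg.exp).ennreal_ofReal
    have hp : Measurable fun B : Matrix (Fin (n k)) (Idx r n) ℝ =>
        ENNReal.ofReal (Real.exp (-fsq B)) := measurable_fsq.neg.exp.ennreal_ofReal
    have key := h.lintegral_schur_aux hV1 hV2 hV3 ht hv hT' hp hq
      (fun B => by rw [← neg_one_smul ℝ B, fsq_smul]; simp)
    have e1 : ∫⁻ x, ENNReal.ofReal (Real.exp
          (-(tip (resetRow k T * (resetRow k T)ᵀ) (schur k x)))) *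
        ENNReal.ofReal (Real.exp (-(tdiag x k * (fsq (aRow k x * resetRow k T) + n k)))) ∂μ =
        ENNReal.ofReal (C * chi (-s) (resetRow k T)) := by
      rw [← h.laplace_eq _ hT', laplace]
      refine lintegral_congr_ae ?_
      filter_upwards [h.ae_mem] with x hx
      rw [tip_resetRow (k := k) hV1 hx hT, ← ENNReal.ofReal_mul (Real.exp_pos _).le,
        ← Real.exp_add, neg_add]
    have e2 : ∫⁻ x, ENNReal.ofReal (Real.exp
          (-(tip (resetRow k T * (resetRow k T)ᵀ) (schur k x)))) *
        (ENNReal.ofReal (Real.exp (-fsq (aRow k x))) * ∫⁻ b : RowIdx V k → ℝ, ENNReal.ofReal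
          (Real.exp (-(tdiag x k * (fsq (rowOf V k b * resetRow k T) + n k))))) ∂μ =
        (∫⁻ x, (w * fun x => ENNReal.ofReal
          (Real.exp (-(tip (T * Tᵀ) (projZ V (schur k x)))))) x ∂μ) *
          (ENNReal.ofReal (chi (-halfDim V k) (resetRow k T)) * gaussK V k) := by
      rw [← lintegral_mul_const' _ _
        (ENNReal.mul_ne_top ENNReal.ofReal_ne_top (gaussK_ne_top k))]
      refine lintegral_congr_ae ?_
      filter_upwards [h.ae_mem, ht, hv] with x hx htx hvx
      rw [lintegral_exp_neg_mul_fsq hV1 hT' hvx, Pi.mul_apply, hw,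
        tip_projZ (mul_transpose_mem_Z hV2 hV3 (mem_Hgrp_iff.1 hT).1),
        tip_schur_resetRow hx htx hvx T]
      ring
    rw [e2, e1, chi_resetRow k s hT, ← mul_assoc C,
      ENNReal.ofReal_mul (mul_pos h.pos (chi_pos _ hT)).le] at key
    have hc0 : ENNReal.ofReal (chi (-halfDim V k) (resetRow k T)) * gaussK V k ≠ 0 :=
      mul_ne_zero (by simpa using chi_pos _ hT') (gaussK_ne_zero k)
    refine (ENNReal.mul_left_inj hc0
      (ENNReal.mul_ne_top ENNReal.ofReal_ne_top (gaussK_ne_top k))).1 ?_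
    rw [← key, gaussK]
    ring

end IsRiesz

namespace IsRiesz

variable {μ : Measure (Mat r n)} {s : Fin (r + 1) → ℝ} {C : ℝ}

theorem lintegral_ray (h : IsRiesz V μ s C) (k : Fin (r + 1)) {t : ℝ} (ht : 0 < t) :
    ∫⁻ x, ENNReal.ofReal (Real.exp (-(tip (diagT (1 - Pi.single k 1)) x +
      t * tip (diagT (Pi.single k 1)) x))) ∂μ = ENNReal.ofReal (C * t ^ (-s k)) := by
  set u : Fin (r + 1) → ℝ := fun i => if i = k then √t else 1 with hu
  have hu0 : ∀ i, 0 < u i := fun i => by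
    simp only [hu]; split_ifs
    · exact Real.sqrt_pos.2 ht
    · exact one_pos
  have h1 := h.laplace_eq _ (diagT_mem_Hgrp hu0)
  have h2 : (diagT u * (diagT u)ᵀ : Mat r n) =
      diagT (1 - Pi.single k 1) + t • diagT (Pi.single k 1) := by
    rw [diagT_transpose, diagT_mul]
    ext p q
    simp only [diagT, Matrix.diagonal_apply, Matrix.add_apply, Matrix.smul_apply]
    split_ifs with hpq
    · by_cases hk : p.1 = k
      · simp [hu, hk, Real.mul_self_sqrt ht.le]
      · simp [hu, hk]
    · simp
  have h3 : chi (-s) (diagT u : Mat r n) = t ^ (-s k) := by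
    rw [chi, Finset.prod_eq_single k]
    · simp only [tdiag_diagT, hu, if_true, Pi.neg_apply]
      rw [Real.sqrt_eq_rpow, ← Real.rpow_mul ht.le]
      congr 1; ring
    · intro i _ hi; simp [tdiag_diagT, hu, hi]
    · simp
  rw [laplace, h2, h3] at h1
  simpa only [tip_add_left, tip_smul_left] using h1

theorem param_nonneg (h : IsRiesz V μ s C) (k : Fin (r + 1)) : 0 ≤ s k := by
  have hY := ae_nonneg_of_growth (μ := μ) (g := tip (diagT (1 - Pi.single k 1)))
    (Y := tip (diagT (Pi.single k 1))) (measurable_tip _) (measurable_tip _) (c := C) (σ := -s k)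
    fun t ht => (h.lintegral_ray k (one_pos.trans_le ht)).le
  have h1 : ENNReal.ofReal (C * 2 ^ (-s k)) ≤ ENNReal.ofReal (C * 1 ^ (-s k)) := by
    rw [← h.lintegral_ray k two_pos, ← h.lintegral_ray k one_pos]
    refine lintegral_mono_ae ?_
    filter_upwards [hY] with x hx
    exact ENNReal.ofReal_le_ofReal (Real.exp_le_exp.2 (by linarith))
  have hC := h.pos
  rw [ENNReal.ofReal_le_ofReal_iff (by positivity), Real.one_rpow, mul_one] at h1
  by_contra! hs
  have : (1 : ℝ) < 2 ^ (-s k) := Real.one_lt_rpow (by norm_num) (by linarith)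
  nlinarith

theorem ae_tdiag_pos (h : IsRiesz V μ s C) {k : Fin (r + 1)} (hs : 0 < s k) :
    ∀ᵐ x ∂μ, 0 < tdiag x k := by
  have hY := ae_pos_of_decay (μ := μ) (g := tip (diagT (1 - Pi.single k 1)))
    (Y := tip (diagT (Pi.single k 1))) (measurable_tip _) (measurable_tip _) (c := C) hs
    fun t ht => (h.lintegral_ray k (one_pos.trans_le ht)).le
  filter_upwards [hY, h.ae_mem] with x hx hxZ
  rw [tip_diagT hxZ, Finset.sum_eq_single k (fun i _ hi => by simp [hi]) (by simp)] at hx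
  rw [Pi.single_eq_same, one_mul] at hx
  exact pos_of_mul_pos_right hx (Nat.cast_nonneg _)

theorem exists_signature (hV1 : CondV1 V) (hV2 : CondV2 V) (hV3 : CondV3 V) (m : ℕ)
    (hm : m ≤ r + 1) (h : IsRiesz V μ s C) (hs : ∀ l : Fin (r + 1), m ≤ l.1 → s l = 0) :
    ∃ ε : Fin (r + 1) → Bool, (∀ l : Fin (r + 1), m ≤ l.1 → ε l = false) ∧
      ∀ k, (ε k = true → ∑ l, (if ε l then halfDim V l k else 0) < s k) ∧
        (ε k = false → s k = ∑ l, (if ε l then halfDim V l k else 0)) := by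
  induction m generalizing μ s C with
  | zero => exact ⟨fun _ => false, by simp, fun k => by simp [hs k]⟩
  | succ m ih =>
    set k : Fin (r + 1) := ⟨m, hm⟩ with hk
    rcases (h.param_nonneg k).eq_or_lt with h0 | h0
    · obtain ⟨ε, h1, h2⟩ := ih (by omega) h fun l hl => by
        rcases hl.eq_or_lt with e | e
        · rw [show l = k from Fin.ext e.symm, ← h0]
        · exact hs l e
      exact ⟨ε, fun l hl => h1 l (by omega), h2⟩
    · have h' := h.map_trunc hs
      have ht : ∀ᵐ x ∂μ.map (trunc (m + 1)), trunc (k.1 + 1) x = x := by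
        exact (ae_map_iff (measurable_trunc _).aemeasurable
          (measurableSet_eq_fun (measurable_trunc _) measurable_id)).2
          (.of_forall fun x => trunc_trunc _ x)
      obtain ⟨ν, hν⟩ := h'.exists_dropParam hV1 hV2 hV3 ht (h'.ae_tdiag_pos h0)
      obtain ⟨ε, h1, h2⟩ := ih (by omega) hν fun l hl => by
        rw [dropParam]
        split_ifs with e
        · rfl
        · have hlk : ¬ l < k := by simp only [hk, Fin.lt_def]; omega
          rw [hs l (by have : l.1 ≠ m := fun e' => e (Fin.ext e'); omega), halfDim, if_neg hlk,
            sub_zero]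
      have hεk : ε k = false := h1 k le_rfl
      have hsum : ∀ i, ∑ l, (if Function.update ε k true l then halfDim V l i else 0) =
          ∑ l, (if ε l then halfDim V l i else 0) + halfDim V k i := fun i => by
        rw [← Finset.add_sum_erase _ _ (Finset.mem_univ k),
          ← Finset.add_sum_erase _ (fun l => if ε l then halfDim V l i else 0)
            (Finset.mem_univ k)]
        have : ∑ l ∈ univ.erase k, (if Function.update ε k true l then halfDim V l i else 0) =
            ∑ l ∈ univ.erase k, (if ε l then halfDim V l i else 0) :=
          Finset.sum_congr rfl fun l hl => by
            rw [Function.update_of_ne (Finset.ne_of_mem_erase hl)]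
        rw [this]
        simp [hεk, add_comm]
      refine ⟨Function.update ε k true, fun l hl => ?_, fun i => ?_⟩
      · rw [Function.update_of_ne (fun e => by subst e; simp [hk] at hl)]
        exact h1 l (by omega)
      · rw [hsum]
        by_cases hi : i = k
        · subst hi
          have h3 := (h2 k).2 hεk
          rw [dropParam, if_pos rfl] at h3
          have h4 : halfDim V k k = 0 := by simp [halfDim]
          refine ⟨fun _ => ?_, fun e => by simp at e⟩
          rw [← h3, h4, add_zero]; exact h0
        · rw [Function.update_of_ne hi]
          have h3 := h2 i
          rw [dropParam, if_neg hi] at h3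
          exact ⟨fun e => by linarith [h3.1 e], fun e => by linarith [h3.2 e]⟩

theorem mem_frakX (hV1 : CondV1 V) (hV2 : CondV2 V) (hV3 : CondV3 V) (h : IsRiesz V μ s C) :
    s ∈ frakX V := by
  obtain ⟨ε, -, h2⟩ := h.exists_signature hV1 hV2 hV3 (r + 1) le_rfl fun l hl => by omega
  exact Set.mem_iUnion.2 ⟨ε, fun k => by rw [frakBound_eq]; exact h2 k⟩

end IsRiesz

end Riesz

/-- There exists a positive measure `R*_s` on `𝒵` whose Laplace transform
satisfies `L_{R*_s}(θ) = Δ_{-s}(θ)` for all `θ ∈ 𝒫` if and only if `s ∈ 𝔛` (the Gindikin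
set); moreover, the support of any such measure is contained in the closure of `𝒬`. -/
theorem statement5 (r : ℕ) (n : Fin (r + 1) → ℕ+)
    (V : ∀ l k : Fin (r + 1), Submodule ℝ (Matrix (Fin (n l)) (Fin (n k)) ℝ))
    (hV1 : CondV1 V) (hV2 : CondV2 V) (hV3 : CondV3 V)
    (Δf : (Fin (r + 1) → ℝ) → Mat r n → ℝ)
    (hΔ : ∀ s : Fin (r + 1) → ℝ, ∀ T ∈ Hgrp V, Δf s (rhoM T 1) = chi s T) :
    ∀ s : Fin (r + 1) → ℝ,
      ((∃ μ : Measure (Mat r n), μ (Zspace V)ᶜ = 0 ∧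
          ∀ θ ∈ Pcone V, laplace μ θ = ENNReal.ofReal (Δf (-s) θ)) ↔ s ∈ frakX V) ∧
      (∀ μ : Measure (Mat r n), μ (Zspace V)ᶜ = 0 →
        (∀ θ ∈ Pcone V, laplace μ θ = ENNReal.ofReal (Δf (-s) θ)) →
        μ (closure (Qcone V))ᶜ = 0) := by
  intro s
  refine ⟨⟨fun ⟨μ, h⟩ => ?_, fun hs => ?_⟩, fun μ h1 h2 => ?_⟩
  · exact ((isRiesz_one_iff hV2 hV3 hΔ).2 h).mem_frakX hV1 hV2 hV3
  · obtain ⟨μ, hμ⟩ := exists_isRiesz_of_mem hV1 hV2 hV3 hs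
    exact ⟨μ, (isRiesz_one_iff hV2 hV3 hΔ).1 hμ⟩
  · exact ((isRiesz_one_iff hV2 hV3 hΔ).2 ⟨h1, h2⟩).support hV2 hV3

end Wishart
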